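/- Let (L,d,[-,-],(-,-)) be a quasi-cyclic DG-Lie algebra of degree 2 over a field K of characteristic 0 with H^i(L) = 0 for every i ∉ {0,1,2}. Assume there exists a Lie subalgebra H^0 ⊆ Z^0(L) (the space of degree-0 cocycles) such that: (1) the projection Z^0(L) → H^0(L) restricts to an isomorphism H^0 ≅ H^0(L); (2) for every i, the graded piece L^i is a completely reducible H^0-module with respect to the adjoint action x ↦ [g,x] (g ∈ H^0). Then the DG-Lie algebra (L,d,[-,-]) is formal. -/

import Mathlib

/-!
Core definitions: differential graded Lie algebras (DGLAs) over a field `K`,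
their cohomology, morphisms, quasi-isomorphisms, zigzags and formality.

A ℤ-graded vector space is encoded as a module `carrier` together with an internal
direct sum decomposition `grading : ℤ → Submodule K carrier`.
-/

/-- A differential graded Lie algebra over `K`.  The differential `d` has degree `+1`,
the bracket `br` is graded skew-symmetric, satisfies the graded Jacobi identity and
`d` is a graded derivation with respect to it. -/
structure DGLA (K : Type) [Field K] : Type 1 where
  carrier : Type
  [acg : AddCommGroup carrier]
  [mod : Module K carrier]
  grading : ℤ → Submodule K carrier
  internal : DirectSum.IsInternal grading
  d : carrier → carrier
  d_lin : IsLinearMap K d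
  d_mem : ∀ i : ℤ, ∀ x ∈ grading i, d x ∈ grading (i + 1)
  d_sq : ∀ x, d (d x) = 0
  br : carrier → carrier → carrier
  br_lin₁ : ∀ y, IsLinearMap K fun x => br x y
  br_lin₂ : ∀ x, IsLinearMap K (br x)
  br_mem : ∀ i j : ℤ, ∀ x ∈ grading i, ∀ y ∈ grading j, br x y ∈ grading (i + j)
  skew : ∀ i j : ℤ, ∀ x ∈ grading i, ∀ y ∈ grading j,
      br x y = -((-1 : K) ^ (i * j) • br y x)
  jacobi : ∀ i j : ℤ, ∀ x ∈ grading i, ∀ y ∈ grading j, ∀ z : carrier,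
      br x (br y z) = br (br x y) z + (-1 : K) ^ (i * j) • br y (br x z)
  leibniz : ∀ i : ℤ, ∀ x ∈ grading i, ∀ y : carrier,
      d (br x y) = br (d x) y + (-1 : K) ^ i • br x (d y)

attribute [instance] DGLA.acg DGLA.mod

variable {K : Type} [Field K]

/-- The differential bundled as a linear map. -/
def DGLA.dHom (A : DGLA K) : A.carrier →ₗ[K] A.carrier := IsLinearMap.mk' A.d A.d_lin

/-- Degree `i` cocycles. -/
def DGLA.cocycles (A : DGLA K) (i : ℤ) : Submodule K A.carrier :=
  A.grading i ⊓ LinearMap.ker A.dHom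

/-- Degree `i` coboundaries. -/
def DGLA.coboundaries (A : DGLA K) (i : ℤ) : Submodule K A.carrier :=
  A.grading i ⊓ LinearMap.range A.dHom

/-- Degree `i` cohomology `H^i(L)` as a quotient vector space. -/
abbrev DGLA.cohomology (A : DGLA K) (i : ℤ) :=
  A.cocycles i ⧸ ((A.coboundaries i).comap (A.cocycles i).subtype)

/-- A morphism of DGLAs. -/
structure DGLAHom (A B : DGLA K) where
  toFun : A.carrier → B.carrier
  lin : IsLinearMap K toFun
  map_grading : ∀ i : ℤ, ∀ x ∈ A.grading i, toFun x ∈ B.grading i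
  map_d : ∀ x, toFun (A.d x) = B.d (toFun x)
  map_br : ∀ x y, toFun (A.br x y) = B.br (toFun x) (toFun y)

/-- `f` is a quasi-isomorphism: it induces bijections on cohomology in every degree. -/
def DGLAHom.IsQuasiIso {A B : DGLA K} (f : DGLAHom A B) : Prop :=
  ∀ i : ℤ,
    (∀ x ∈ A.cocycles i, f.toFun x ∈ B.coboundaries i → x ∈ A.coboundaries i) ∧
    (∀ y ∈ B.cocycles i, ∃ x ∈ A.cocycles i, f.toFun x - y ∈ B.coboundaries i)

/-- There exists a quasi-isomorphism `A → B`. -/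
def QIso (A B : DGLA K) : Prop := ∃ f : DGLAHom A B, f.IsQuasiIso

/-- Two DGLAs are connected by a zigzag of quasi-isomorphisms. -/
inductive ZigzagQIso : DGLA K → DGLA K → Prop
  | of {A B : DGLA K} : QIso A B → ZigzagQIso A B
  | refl (A : DGLA K) : ZigzagQIso A A
  | symm {A B : DGLA K} : ZigzagQIso A B → ZigzagQIso B A
  | trans {A B C : DGLA K} : ZigzagQIso A B → ZigzagQIso B C → ZigzagQIso A C

/-- A DGLA is formal if it is connected by a zigzag of quasi-isomorphisms to a DGLA
with zero differential.  (This is equivalent to being connected by a zigzag of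
quasi-isomorphisms to its cohomology `H^*(L)` endowed with the zero differential and
the induced bracket: any zero-differential DGLA quasi-isomorphic to `L` is isomorphic,
as a graded Lie algebra, to `H^*(L)` with the induced bracket.) -/
def DGLA.IsFormal (A : DGLA K) : Prop :=
  ∃ M : DGLA K, (∀ x, M.d x = 0) ∧ ZigzagQIso A M

/-- A quasi-cyclic DGLA of degree `n`: a DGLA with finite dimensional cohomology
equipped with a graded symmetric bilinear form of degree `-n`, compatible with `d`
and cyclic with respect to the bracket, whose induced pairing on cohomology is
non-degenerate. -/
structure QCyclicDGLA (K : Type) [Field K] (n : ℤ) extends DGLA K where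
  form : carrier → carrier → K
  form_lin₁ : ∀ y, IsLinearMap K fun x => form x y
  form_lin₂ : ∀ x, IsLinearMap K (form x)
  findim : ∀ i : ℤ, FiniteDimensional K (toDGLA.cohomology i)
  form_degree : ∀ i j : ℤ, i + j ≠ n → ∀ x ∈ grading i, ∀ y ∈ grading j, form x y = 0
  form_symm : ∀ i j : ℤ, ∀ x ∈ grading i, ∀ y ∈ grading j,
      form x y = (-1 : K) ^ (i * j) * form y x
  form_d : ∀ i : ℤ, ∀ x ∈ grading i, ∀ y,
      form (d x) y = (-1 : K) ^ (i + 1) * form x (d y)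
  form_cyclic : ∀ x y z, form (br x y) z = form x (br y z)
  nondeg : ∀ i : ℤ, ∀ x ∈ toDGLA.cocycles i,
      (∀ y ∈ toDGLA.cocycles (n - i), form x y = 0) → x ∈ toDGLA.coboundaries i

/-- A splitting `L = H ⊕ d(K) ⊕ K` of the complex `(L, d)` into graded subspaces:
`d` vanishes on `H`, is injective on `K = Kc`, and in every degree `i` one has the
internal direct sum `L^i = H^i ⊕ d(K^{i-1}) ⊕ K^i`. -/
structure GradedSplitting (A : DGLA K) where
  H : ℤ → Submodule K A.carrier
  Kc : ℤ → Submodule K A.carrier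
  H_le : ∀ i, H i ≤ A.grading i
  Kc_le : ∀ i, Kc i ≤ A.grading i
  d_H : ∀ i, ∀ x ∈ H i, A.d x = 0
  d_Kc_inj : ∀ i, ∀ x ∈ Kc i, A.d x = 0 → x = 0
  decomp : ∀ i, H i ⊔ ((Kc (i - 1)).map A.dHom ⊔ Kc i) = A.grading i
  disj₁ : ∀ i, Disjoint (H i) ((Kc (i - 1)).map A.dHom ⊔ Kc i)
  disj₂ : ∀ i, Disjoint ((Kc (i - 1)).map A.dHom) (Kc i)

/-- The contraction data `(π, h)` determined by a splitting `L = H ⊕ d(K) ⊕ K`: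
`pr` is the projection onto `H`, and `h` the degree `-1` homotopy given by projecting
onto `d(K)`, applying `-d⁻¹` and including `K` into `L`.  The listed identities
determine `pr` and `h` uniquely. -/
structure ContractionData (A : DGLA K) (S : GradedSplitting A) where
  pr : A.carrier → A.carrier
  h : A.carrier → A.carrier
  pr_lin : IsLinearMap K pr
  h_lin : IsLinearMap K h
  pr_H : ∀ i : ℤ, ∀ x ∈ S.H i, pr x = x
  pr_dK : ∀ i : ℤ, ∀ x ∈ S.Kc i, pr (A.d x) = 0
  pr_K : ∀ i : ℤ, ∀ x ∈ S.Kc i, pr x = 0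
  h_H : ∀ i : ℤ, ∀ x ∈ S.H i, h x = 0
  h_dK : ∀ i : ℤ, ∀ x ∈ S.Kc i, h (A.d x) = -x
  h_K : ∀ i : ℤ, ∀ x ∈ S.Kc i, h x = 0

/-! ### Differential graded Lie algebras concentrated in degrees `0, 1, 2, 3` -/

/-- The structure maps of a DG-Lie algebra concentrated in degrees `0, 1, 2, 3` whose differential
vanishes in degree `0`. -/
structure FourTerm (K : Type) [Field K] (G P₁ P₂ P₃ : Type)
    [AddCommGroup G] [Module K G] [AddCommGroup P₁] [Module K P₁]
    [AddCommGroup P₂] [Module K P₂] [AddCommGroup P₃] [Module K P₃] where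
  lie : G →ₗ[K] G →ₗ[K] G
  a₁ : G →ₗ[K] P₁ →ₗ[K] P₁
  a₂ : G →ₗ[K] P₂ →ₗ[K] P₂
  a₃ : G →ₗ[K] P₃ →ₗ[K] P₃
  q : P₁ →ₗ[K] P₁ →ₗ[K] P₂
  t : P₁ →ₗ[K] P₂ →ₗ[K] P₃
  d₁ : P₁ →ₗ[K] P₂
  d₂ : P₂ →ₗ[K] P₃
  lie_skew : ∀ x y, lie x y = -lie y x
  lie_jacobi : ∀ x y z, lie x (lie y z) = lie (lie x y) z + lie y (lie x z)
  a₁_lie : ∀ x y p, a₁ x (a₁ y p) = a₁ (lie x y) p + a₁ y (a₁ x p)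
  a₂_lie : ∀ x y p, a₂ x (a₂ y p) = a₂ (lie x y) p + a₂ y (a₂ x p)
  a₃_lie : ∀ x y p, a₃ x (a₃ y p) = a₃ (lie x y) p + a₃ y (a₃ x p)
  q_symm : ∀ a b, q a b = q b a
  a₂_q : ∀ x a b, a₂ x (q a b) = q (a₁ x a) b + q a (a₁ x b)
  a₃_t : ∀ x a f, a₃ x (t a f) = t (a₁ x a) f + t a (a₂ x f)
  t_jacobi : ∀ a b c, t a (q b c) + t b (q c a) + t c (q a b) = 0
  d₁_a : ∀ x p, d₁ (a₁ x p) = a₂ x (d₁ p)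
  d₂_a : ∀ x p, d₂ (a₂ x p) = a₃ x (d₂ p)
  d_d : ∀ p, d₂ (d₁ p) = 0
  d₂_q : ∀ a b, d₂ (q a b) = -t a (d₁ b) - t b (d₁ a)

namespace FourTerm

section

variable {G P₁ P₂ P₃ : Type}
    [AddCommGroup G] [Module K G] [AddCommGroup P₁] [Module K P₁]
    [AddCommGroup P₂] [Module K P₂] [AddCommGroup P₃] [Module K P₃]

/-- The degree `i` part of `G × P₁ × P₂ × P₃`. -/
def gr (K : Type) [Field K] (G P₁ P₂ P₃ : Type)
    [AddCommGroup G] [Module K G] [AddCommGroup P₁] [Module K P₁]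
    [AddCommGroup P₂] [Module K P₂] [AddCommGroup P₃] [Module K P₃]
    (i : ℤ) : Submodule K (G × P₁ × P₂ × P₃) where
  carrier := {x | (i ≠ 0 → x.1 = 0) ∧ (i ≠ 1 → x.2.1 = 0) ∧ (i ≠ 2 → x.2.2.1 = 0) ∧
    (i ≠ 3 → x.2.2.2 = 0)}
  add_mem' := by
    rintro x y ⟨h0, h1, h2, h3⟩ ⟨k0, k1, k2, k3⟩
    refine ⟨fun h => ?_, fun h => ?_, fun h => ?_, fun h => ?_⟩ <;> simp_all
  zero_mem' := by simp
  smul_mem' := by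
    rintro c x ⟨h0, h1, h2, h3⟩
    refine ⟨fun h => ?_, fun h => ?_, fun h => ?_, fun h => ?_⟩ <;> simp_all

theorem mem_gr {i : ℤ} {x : G × P₁ × P₂ × P₃} : x ∈ gr K G P₁ P₂ P₃ i ↔
    (i ≠ 0 → x.1 = 0) ∧ (i ≠ 1 → x.2.1 = 0) ∧ (i ≠ 2 → x.2.2.1 = 0) ∧ (i ≠ 3 → x.2.2.2 = 0) :=
  Iff.rfl

theorem gr_cases {i : ℤ} {x : G × P₁ × P₂ × P₃} (hx : x ∈ gr K G P₁ P₂ P₃ i) :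
    x = 0 ∨ (i = 0 ∧ ∃ g, x = (g, 0, 0, 0)) ∨ (i = 1 ∧ ∃ a, x = (0, a, 0, 0)) ∨
      (i = 2 ∧ ∃ f, x = (0, 0, f, 0)) ∨ (i = 3 ∧ ∃ s, x = (0, 0, 0, s)) := by
  obtain ⟨g, a, f, s⟩ := x
  obtain ⟨h0, h1, h2, h3⟩ := hx
  by_cases i0 : i = 0
  · subst i0; simp_all
  by_cases i1 : i = 1
  · subst i1; simp_all
  by_cases i2 : i = 2
  · subst i2; simp_all
  by_cases i3 : i = 3
  · subst i3; simp_all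
  left; simp_all

theorem gr_internal : DirectSum.IsInternal (gr K G P₁ P₂ P₃) := by
  classical
  rw [DirectSum.isInternal_submodule_iff_iSupIndep_and_iSup_eq_top]
  constructor
  · rw [iSupIndep_iff_forall_dfinsupp]
    intro i x v hv
    have key : (x : G × P₁ × P₂ × P₃) ∈ gr K G P₁ P₂ P₃ i ∧
        ((i = 0 → (x : G × P₁ × P₂ × P₃).1 = 0) ∧ (i = 1 → (x : G × P₁ × P₂ × P₃).2.1 = 0) ∧
        (i = 2 → (x : G × P₁ × P₂ × P₃).2.2.1 = 0) ∧
        (i = 3 → (x : G × P₁ × P₂ × P₃).2.2.2 = 0)) := by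
      refine ⟨x.2, ?_⟩
      rw [← hv]
      let N : Submodule K (G × P₁ × P₂ × P₃) :=
        { carrier := {x | (i = 0 → x.1 = 0) ∧ (i = 1 → x.2.1 = 0) ∧ (i = 2 → x.2.2.1 = 0) ∧
            (i = 3 → x.2.2.2 = 0)}
          add_mem' := by
            rintro x y ⟨h0, h1, h2, h3⟩ ⟨k0, k1, k2, k3⟩
            refine ⟨fun h => ?_, fun h => ?_, fun h => ?_, fun h => ?_⟩ <;> simp_all
          zero_mem' := by simp
          smul_mem' := by
            rintro c x ⟨h0, h1, h2, h3⟩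
            refine ⟨fun h => ?_, fun h => ?_, fun h => ?_, fun h => ?_⟩ <;> simp_all }
      change _ ∈ N
      rw [DFinsupp.lsum_apply_apply, DFinsupp.sumAddHom_apply]
      refine Submodule.sum_mem _ fun j _ => ?_
      by_cases hij : j = i
      · subst hij
        simp
      · rw [DFinsupp.erase_ne hij]
        obtain ⟨h0, h1, h2, h3⟩ := (v j).2
        refine ⟨fun h => h0 ?_, fun h => h1 ?_, fun h => h2 ?_, fun h => h3 ?_⟩ <;>
          (rintro rfl; exact hij h.symm)
    obtain ⟨x, hx⟩ := x
    obtain ⟨⟨h0, h1, h2, h3⟩, k0, k1, k2, k3⟩ := key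
    ext
    · by_cases h : i = 0 <;> simp_all
    · by_cases h : i = 1 <;> simp_all
    · by_cases h : i = 2 <;> simp_all
    · by_cases h : i = 3 <;> simp_all
  · rw [eq_top_iff]
    rintro ⟨g, a, f, s⟩ -
    have : ((g, a, f, s) : G × P₁ × P₂ × P₃) =
        (g, 0, 0, 0) + (0, a, 0, 0) + (0, 0, f, 0) + (0, 0, 0, s) := by simp
    rw [this]
    refine add_mem (add_mem (add_mem ?_ ?_) ?_) ?_
    · exact Submodule.mem_iSup_of_mem 0 (by simp [mem_gr])
    · exact Submodule.mem_iSup_of_mem 1 (by simp [mem_gr])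
    · exact Submodule.mem_iSup_of_mem 2 (by simp [mem_gr])
    · exact Submodule.mem_iSup_of_mem 3 (by simp [mem_gr])

/-- The bracket of a four-term DG-Lie algebra. -/
def br (X : FourTerm K G P₁ P₂ P₃) (x y : G × P₁ × P₂ × P₃) : G × P₁ × P₂ × P₃ :=
  (X.lie x.1 y.1, X.a₁ x.1 y.2.1 - X.a₁ y.1 x.2.1,
    X.a₂ x.1 y.2.2.1 - X.a₂ y.1 x.2.2.1 + X.q x.2.1 y.2.1,
    X.a₃ x.1 y.2.2.2 - X.a₃ y.1 x.2.2.2 + X.t x.2.1 y.2.2.1 - X.t y.2.1 x.2.2.1)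

/-- The DG-Lie algebra with the given structure maps. -/
def toDGLA (X : FourTerm K G P₁ P₂ P₃) : DGLA K where
  carrier := G × P₁ × P₂ × P₃
  grading := gr K G P₁ P₂ P₃
  internal := gr_internal
  d x := (0, 0, X.d₁ x.2.1, X.d₂ x.2.2.1)
  d_lin := ⟨fun x y => by simp, fun c x => by simp⟩
  d_mem i x hx := by
    rcases gr_cases hx with rfl | ⟨rfl, g, rfl⟩ | ⟨rfl, a, rfl⟩ | ⟨rfl, f, rfl⟩ | ⟨rfl, s, rfl⟩ <;>
      simp [mem_gr]
  d_sq x := by simp [X.d_d]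
  br := X.br
  br_lin₁ y := ⟨fun x x' => by
      simp only [br, Prod.fst_add, Prod.snd_add, map_add, LinearMap.add_apply, Prod.mk_add_mk,
        Prod.mk.injEq]
      refine ⟨trivial, ?_, ?_, ?_⟩ <;> abel,
    fun c x => by
      simp only [br, Prod.smul_fst, Prod.smul_snd, map_smul, LinearMap.smul_apply, Prod.smul_mk,
        smul_add, smul_sub]⟩
  br_lin₂ y := ⟨fun x x' => by
      simp only [br, Prod.fst_add, Prod.snd_add, map_add, LinearMap.add_apply, Prod.mk_add_mk,
        Prod.mk.injEq]
      refine ⟨trivial, ?_, ?_, ?_⟩ <;> abel,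
    fun c x => by
      simp only [br, Prod.smul_fst, Prod.smul_snd, map_smul, LinearMap.smul_apply, Prod.smul_mk,
        smul_add, smul_sub]⟩
  br_mem i j x hx y hy := by
    rcases gr_cases hx with rfl | ⟨rfl, g, rfl⟩ | ⟨rfl, a, rfl⟩ | ⟨rfl, f, rfl⟩ | ⟨rfl, s, rfl⟩ <;>
    rcases gr_cases hy with rfl | ⟨rfl, g', rfl⟩ | ⟨rfl, a', rfl⟩ | ⟨rfl, f', rfl⟩ |
      ⟨rfl, s', rfl⟩ <;>
    simp [mem_gr, br]
  skew i j x hx y hy := by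
    rcases gr_cases hx with rfl | ⟨rfl, g, rfl⟩ | ⟨rfl, a, rfl⟩ | ⟨rfl, f, rfl⟩ | ⟨rfl, s, rfl⟩ <;>
    rcases gr_cases hy with rfl | ⟨rfl, g', rfl⟩ | ⟨rfl, a', rfl⟩ | ⟨rfl, f', rfl⟩ |
      ⟨rfl, s', rfl⟩ <;>
    simp [br, ← X.lie_skew, ← X.q_symm]
  jacobi i j x hx y hy z := by
    obtain ⟨u, b, e, r⟩ := z
    rcases gr_cases hx with rfl | ⟨rfl, g, rfl⟩ | ⟨rfl, a, rfl⟩ | ⟨rfl, f, rfl⟩ | ⟨rfl, s, rfl⟩ <;>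
    rcases gr_cases hy with rfl | ⟨rfl, g', rfl⟩ | ⟨rfl, a', rfl⟩ | ⟨rfl, f', rfl⟩ |
      ⟨rfl, s', rfl⟩ <;>
    simp [br]
    · exact ⟨X.lie_jacobi _ _ _, X.a₁_lie _ _ _, X.a₂_lie _ _ _, X.a₃_lie _ _ _⟩
    · exact ⟨by rw [X.a₁_lie]; abel, X.a₂_q _ _ _, X.a₃_t _ _ _⟩
    · exact ⟨by rw [X.a₂_lie]; abel, by rw [X.a₃_t]; abel⟩
    · rw [X.a₃_lie]; abel
    · exact ⟨by rw [X.a₁_lie u, X.lie_skew u]; simp, by rw [X.a₂_q]; abel, by rw [X.a₃_t]; abel⟩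
    · refine ⟨by rw [X.a₂_q, X.q_symm a']; abel, ?_⟩
      have h := X.t_jacobi a a' b
      rw [X.q_symm b a, add_assoc, add_eq_zero_iff_eq_neg] at h
      rw [h]; abel
    · rw [X.a₃_t]; abel
    · exact ⟨by rw [X.a₂_lie u, X.lie_skew u]; simp, by rw [X.a₃_t]; abel⟩
    · rw [X.a₃_t]; abel
    · rw [X.a₃_lie u, X.lie_skew u]; simp
  leibniz i x hx y := by
    obtain ⟨u, b, e, r⟩ := y
    rcases gr_cases hx with rfl | ⟨rfl, g, rfl⟩ | ⟨rfl, a, rfl⟩ | ⟨rfl, f, rfl⟩ | ⟨rfl, s, rfl⟩ <;>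
    simp [br]
    · exact ⟨X.d₁_a _ _, X.d₂_a _ _⟩
    · exact ⟨X.d₁_a _ _, by rw [X.d₂_q]; abel⟩
    · exact X.d₂_a _ _

@[simp] theorem mem_cocycles {X : FourTerm K G P₁ P₂ P₃} {i : ℤ} {x : G × P₁ × P₂ × P₃} :
    x ∈ X.toDGLA.cocycles i ↔ x ∈ gr K G P₁ P₂ P₃ i ∧ X.d₁ x.2.1 = 0 ∧ X.d₂ x.2.2.1 = 0 := by
  change _ ∧ ((0 : G), (0 : P₁), X.d₁ x.2.1, X.d₂ x.2.2.1) = 0 ↔ _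
  refine and_congr Iff.rfl ?_
  simp

@[simp] theorem mem_coboundaries {X : FourTerm K G P₁ P₂ P₃} {i : ℤ} {x : G × P₁ × P₂ × P₃} :
    x ∈ X.toDGLA.coboundaries i ↔ x ∈ gr K G P₁ P₂ P₃ i ∧ x.1 = 0 ∧ x.2.1 = 0 ∧
      (∃ a, X.d₁ a = x.2.2.1) ∧ ∃ f, X.d₂ f = x.2.2.2 := by
  change _ ∧ (∃ y : G × P₁ × P₂ × P₃, ((0 : G), (0 : P₁), X.d₁ y.2.1, X.d₂ y.2.2.1) = x) ↔ _
  obtain ⟨g, a, f, s⟩ := x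
  refine and_congr Iff.rfl ⟨?_, ?_⟩
  · rintro ⟨⟨g', a', f', s'⟩, h⟩
    simp only [Prod.mk.injEq] at h
    exact ⟨h.1.symm, h.2.1.symm, ⟨a', h.2.2.1⟩, f', h.2.2.2⟩
  · rintro ⟨rfl, rfl, ⟨a', h⟩, f', h'⟩
    exact ⟨(0, a', f', 0), by simp_all⟩

end

section

variable {G P₁ P₂ P₃ Q₁ Q₂ Q₃ : Type}
    [AddCommGroup G] [Module K G] [AddCommGroup P₁] [Module K P₁]
    [AddCommGroup P₂] [Module K P₂] [AddCommGroup P₃] [Module K P₃]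
    [AddCommGroup Q₁] [Module K Q₁]
    [AddCommGroup Q₂] [Module K Q₂] [AddCommGroup Q₃] [Module K Q₃]

/-- A morphism of four-term DG-Lie algebras which is the identity in degree `0`. -/
structure Hom (X : FourTerm K G P₁ P₂ P₃) (Y : FourTerm K G Q₁ Q₂ Q₃) where
  f₁ : P₁ →ₗ[K] Q₁
  f₂ : P₂ →ₗ[K] Q₂
  f₃ : P₃ →ₗ[K] Q₃
  lie_eq : X.lie = Y.lie
  map_a₁ : ∀ x p, f₁ (X.a₁ x p) = Y.a₁ x (f₁ p)
  map_a₂ : ∀ x p, f₂ (X.a₂ x p) = Y.a₂ x (f₂ p)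
  map_a₃ : ∀ x p, f₃ (X.a₃ x p) = Y.a₃ x (f₃ p)
  map_q : ∀ a b, f₂ (X.q a b) = Y.q (f₁ a) (f₁ b)
  map_t : ∀ a f, f₃ (X.t a f) = Y.t (f₁ a) (f₂ f)
  map_d₁ : ∀ a, f₂ (X.d₁ a) = Y.d₁ (f₁ a)
  map_d₂ : ∀ f, f₃ (X.d₂ f) = Y.d₂ (f₂ f)

variable {X : FourTerm K G P₁ P₂ P₃} {Y : FourTerm K G Q₁ Q₂ Q₃}

/-- The morphism of DG-Lie algebras attached to a morphism of four-term structures. -/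
def Hom.toDGLAHom (F : Hom X Y) : DGLAHom X.toDGLA Y.toDGLA where
  toFun (x : G × P₁ × P₂ × P₃) := ((x.1, F.f₁ x.2.1, F.f₂ x.2.2.1, F.f₃ x.2.2.2) :
    G × Q₁ × Q₂ × Q₃)
  lin := ⟨fun (x y : G × P₁ × P₂ × P₃) => by
      change _ = ((_ : G × Q₁ × Q₂ × Q₃) + _ : G × Q₁ × Q₂ × Q₃)
      change (((x + y).1, F.f₁ (x + y).2.1, F.f₂ (x + y).2.2.1, F.f₃ (x + y).2.2.2) :
        G × Q₁ × Q₂ × Q₃) = _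
      simp,
    fun c (x : G × P₁ × P₂ × P₃) => by
      change (((c • x).1, F.f₁ (c • x).2.1, F.f₂ (c • x).2.2.1, F.f₃ (c • x).2.2.2) :
        G × Q₁ × Q₂ × Q₃) = c • ((_, _, _, _) : G × Q₁ × Q₂ × Q₃)
      simp⟩
  map_grading i x hx := by
    rcases gr_cases hx with rfl | ⟨rfl, g, rfl⟩ | ⟨rfl, a, rfl⟩ | ⟨rfl, f, rfl⟩ | ⟨rfl, s, rfl⟩ <;>
      exact mem_gr.2 (by simp)
  map_d x := by simp [toDGLA, F.map_d₁, F.map_d₂]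
  map_br x y := by
    simp [toDGLA, br, F.map_a₁, F.map_a₂, F.map_a₃, F.map_q, F.map_t, F.lie_eq]

/-- A criterion for a morphism of four-term DG-Lie algebras to be a quasi-isomorphism. -/
theorem Hom.qIso (F : Hom X Y)
    (inj₁ : ∀ a, X.d₁ a = 0 → F.f₁ a = 0 → a = 0)
    (surj₁ : ∀ b, Y.d₁ b = 0 → ∃ a, X.d₁ a = 0 ∧ F.f₁ a = b)
    (inj₂ : ∀ f b, X.d₂ f = 0 → Y.d₁ b = F.f₂ f → ∃ a, X.d₁ a = f)
    (surj₂ : ∀ f, Y.d₂ f = 0 → ∃ e b, X.d₂ e = 0 ∧ Y.d₁ b = F.f₂ e - f)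
    (top_left : Function.Surjective X.d₂) (top_right : Function.Surjective Y.d₂) :
    QIso X.toDGLA Y.toDGLA := by
  refine ⟨F.toDGLAHom, fun i => ⟨fun (x : G × P₁ × P₂ × P₃) hx hx' => ?_,
    fun (y : G × Q₁ × Q₂ × Q₃) hy => ?_⟩⟩
  · obtain ⟨g, a, f, s⟩ := x
    obtain ⟨hg, h1, h2⟩ := mem_cocycles.1 hx
    obtain ⟨-, k0, k1, ⟨b, k2⟩, -⟩ := mem_coboundaries.1 hx'
    exact mem_coboundaries.2 ⟨hg, k0, inj₁ _ h1 k1, inj₂ _ b h2 k2, top_left _⟩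
  · obtain ⟨hg, h1, h2⟩ := mem_cocycles.1 hy
    rcases gr_cases hg with rfl | ⟨rfl, g, rfl⟩ | ⟨rfl, a, rfl⟩ | ⟨rfl, f, rfl⟩ | ⟨rfl, s, rfl⟩
    · refine ⟨0, Submodule.zero_mem _, ?_⟩
      rw [show F.toDGLAHom.toFun 0 = 0 from F.toDGLAHom.lin.map_zero]
      change (0 : G × Q₁ × Q₂ × Q₃) - 0 ∈ _
      rw [sub_zero]
      exact Submodule.zero_mem _
    · refine ⟨((g, 0, 0, 0) : G × P₁ × P₂ × P₃), mem_cocycles.2 ⟨mem_gr.2 (by simp), by simp⟩,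
        mem_coboundaries (x := (g - g, F.f₁ 0 - 0, F.f₂ 0 - 0, F.f₃ 0 - 0)).2
          ⟨mem_gr.2 (by simp), by simp, by simp, ⟨0, by simp⟩, 0, by simp⟩⟩
    · obtain ⟨b, hb, rfl⟩ := surj₁ a h1
      exact ⟨((0, b, 0, 0) : G × P₁ × P₂ × P₃), mem_cocycles.2 ⟨mem_gr.2 (by simp), by simpa⟩,
        mem_coboundaries (x := (0 - 0, F.f₁ b - F.f₁ b, F.f₂ 0 - 0, F.f₃ 0 - 0)).2
          ⟨mem_gr.2 (by simp), by simp, by simp, ⟨0, by simp⟩, 0, by simp⟩⟩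
    · obtain ⟨e, b, he, hb⟩ := surj₂ f h2
      exact ⟨((0, 0, e, 0) : G × P₁ × P₂ × P₃), mem_cocycles.2 ⟨mem_gr.2 (by simp), by simpa⟩,
        mem_coboundaries (x := (0 - 0, F.f₁ 0 - 0, F.f₂ e - f, F.f₃ 0 - 0)).2
          ⟨mem_gr.2 (by simp), by simp, by simp, ⟨b, hb⟩, 0, by simp⟩⟩
    · obtain ⟨f, hf⟩ := top_right (-s)
      exact ⟨((0, 0, 0, 0) : G × P₁ × P₂ × P₃), mem_cocycles.2 ⟨mem_gr.2 (by simp), by simp⟩,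
        mem_coboundaries (x := (0 - 0, F.f₁ 0 - 0, F.f₂ 0 - 0, F.f₃ 0 - s)).2
          ⟨mem_gr.2 (by simp), by simp, by simp, ⟨0, by simp⟩, f, by simp [hf]⟩⟩

end

end FourTerm

/-! ### Polynomials, their coproduct and the action of endomorphisms -/

namespace PolyModel

open MvPolynomial TensorProduct

section

variable {V ι : Type} [AddCommGroup V] [Module K V]

/-- The substitution `p ↦ p(s x + t y)`. -/
noncomputable def ev (K ι : Type) [Field K] (s t : K) :
    MvPolynomial ι K →ₐ[K] MvPolynomial ι K ⊗[K] MvPolynomial ι K :=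
  aeval fun i => s • (X i ⊗ₜ[K] 1) + t • (1 ⊗ₜ[K] X i)

/-- The substitution `f ↦ f(s x + t y, s' x + t' y)`. -/
noncomputable def ev₂ (K ι : Type) [Field K] (s t s' t' : K) :
    MvPolynomial ι K ⊗[K] MvPolynomial ι K →ₐ[K] MvPolynomial ι K ⊗[K] MvPolynomial ι K :=
  Algebra.TensorProduct.productMap (ev K ι s t) (ev K ι s' t')

@[simp] theorem ev_X (s t : K) (i : ι) :
    ev K ι s t (X i) = s • (X i ⊗ₜ[K] 1) + t • (1 ⊗ₜ[K] X i) := by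
  simp [ev]

theorem ev_one_zero (p : MvPolynomial ι K) : ev K ι 1 0 p = p ⊗ₜ[K] 1 := by
  have : ev K ι 1 0 = Algebra.TensorProduct.includeLeft := by
    ext i
    simp
  rw [this]
  rfl

theorem ev_zero_one (p : MvPolynomial ι K) : ev K ι 0 1 p = 1 ⊗ₜ[K] p := by
  have : ev K ι 0 1 = Algebra.TensorProduct.includeRight := by
    ext i
    simp
  rw [this]
  rfl

theorem tmul_eq_mul (p r : MvPolynomial ι K) : p ⊗ₜ[K] r = ev K ι 1 0 p * ev K ι 0 1 r := by
  rw [ev_one_zero, ev_zero_one, Algebra.TensorProduct.tmul_mul_tmul, one_mul, mul_one]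

@[simp] theorem ev₂_tmul (s t s' t' : K) (p r : MvPolynomial ι K) :
    ev₂ K ι s t s' t' (p ⊗ₜ[K] r) = ev K ι s t p * ev K ι s' t' r := rfl

@[simp] theorem ev₂_ev (s t s' t' m n : K) (p : MvPolynomial ι K) :
    ev₂ K ι s t s' t' (ev K ι m n p) = ev K ι (m * s + n * s') (m * t + n * t') p := by
  have : (ev₂ K ι s t s' t').comp (ev K ι m n) =
      ev K ι (m * s + n * s') (m * t + n * t') := by
    ext i
    simp [smul_smul, add_smul]
    abel
  rw [← this]
  rfl

theorem map_monomial_of_smul {A : Type} [CommRing A] [Algebra K A]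
    (φ ψ : MvPolynomial ι K →ₐ[K] A) (c : K) (h : ∀ i, ψ (X i) = c • φ (X i)) (α : ι →₀ ℕ) (a : K) :
    ψ (monomial α a) = c ^ α.degree • φ (monomial α a) := by
  induction α using Finsupp.induction_linear generalizing a with
  | zero =>
    have : (monomial 0 a : MvPolynomial ι K) = a • 1 := by
      rw [← MvPolynomial.C_eq_smul_one]; rfl
    rw [this]
    simp
  | add f g hf hg =>
    have : (monomial (f + g) a : MvPolynomial ι K) = monomial f a * monomial g 1 := by
      simp [monomial_mul]
    rw [this, map_mul, map_mul, hf, hg, map_add, pow_add, smul_mul_smul_comm]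
  | single i n =>
    have : (monomial (Finsupp.single i n) a : MvPolynomial ι K) = a • X i ^ n := by
      rw [X_pow_eq_monomial, smul_monomial, smul_eq_mul, mul_one]
    rw [this, map_smul, map_smul, map_pow, map_pow, h, smul_pow, Finsupp.degree_single,
      smul_comm]

/-- The primitive part `p(x + y) - p(x) - p(y)` of the coproduct. -/
noncomputable def coboundary (K ι : Type) [Field K] :
    MvPolynomial ι K →ₗ[K] MvPolynomial ι K ⊗[K] MvPolynomial ι K :=
  (ev K ι 1 1).toLinearMap - (ev K ι 1 0).toLinearMap - (ev K ι 0 1).toLinearMap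

theorem coboundary_apply (p : MvPolynomial ι K) :
    coboundary K ι p = ev K ι 1 1 p - ev K ι 1 0 p - ev K ι 0 1 p := rfl

/-- The rescaling operator `f ↦ f(2 * x, 2 * y) - 2 f(x, y) + f(x, 0) + f(0, y) - 2 f(0, 0)`. -/
noncomputable def rescale (K ι : Type) [Field K] :
    MvPolynomial ι K ⊗[K] MvPolynomial ι K →ₗ[K] MvPolynomial ι K ⊗[K] MvPolynomial ι K :=
  (ev₂ K ι 2 0 0 2).toLinearMap - (2 : K) • (ev₂ K ι 1 0 0 1).toLinearMap +
    (ev₂ K ι 1 0 0 0).toLinearMap + (ev₂ K ι 0 0 0 1).toLinearMap -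
    (2 : K) • (ev₂ K ι 0 0 0 0).toLinearMap

theorem rescale_apply (f : MvPolynomial ι K ⊗[K] MvPolynomial ι K) :
    rescale K ι f = ev₂ K ι 2 0 0 2 f - (2 : K) • ev₂ K ι 1 0 0 1 f + ev₂ K ι 1 0 0 0 f +
      ev₂ K ι 0 0 0 1 f - (2 : K) • ev₂ K ι 0 0 0 0 f := rfl

/-- The operator `p ↦ p(2 * x) - 2 p(x)`. -/
noncomputable def rescale₁ (K ι : Type) [Field K] : MvPolynomial ι K →ₗ[K] MvPolynomial ι K :=
  (aeval fun i => (2 : K) • (X i : MvPolynomial ι K)).toLinearMap - (2 : K) • LinearMap.id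

theorem ev_double (s t : K) (p : MvPolynomial ι K) :
    ev K ι s t (aeval (fun i => (2 : K) • (X i : MvPolynomial ι K)) p) =
      ev K ι (2 * s) (2 * t) p := by
  have : (ev K ι s t).comp (aeval fun i => (2 : K) • (X i : MvPolynomial ι K)) =
      ev K ι (2 * s) (2 * t) := by
    ext i
    simp [smul_smul]
  rw [← this]
  rfl

theorem rescale_coboundary (p : MvPolynomial ι K) :
    rescale K ι (coboundary K ι p) = coboundary K ι (rescale₁ K ι p) := by
  simp only [rescale_apply, coboundary_apply, rescale₁, LinearMap.sub_apply, LinearMap.smul_apply,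
    map_sub, ev₂_ev, AlgHom.toLinearMap_apply, map_smul, ev_double, LinearMap.id_apply]
  norm_num
  module

theorem rescale_monomial (α β : ι →₀ ℕ) :
    rescale K ι (monomial α 1 ⊗ₜ[K] monomial β 1) =
      ((2 : K) ^ α.degree * 2 ^ β.degree - 2 + 0 ^ β.degree + 0 ^ α.degree -
        2 * (0 ^ α.degree * 0 ^ β.degree)) • (monomial α 1 ⊗ₜ[K] monomial β 1) := by
  have h (s t c m n : K) (h₁ : s = c * m) (h₂ : t = c * n) (α : ι →₀ ℕ) :
      ev K ι s t (monomial α 1) = c ^ α.degree • ev K ι m n (monomial α 1) :=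
    map_monomial_of_smul _ _ c (fun i => by simp [h₁, h₂, smul_smul]) α 1
  simp only [rescale_apply, ev₂_tmul]
  rw [h 2 0 2 1 0 (by simp) (by simp), h 0 2 2 0 1 (by simp) (by simp), h 0 0 0 1 0 (by simp)
    (by simp) α, h 0 0 0 0 1 (by simp) (by simp) β, tmul_eq_mul]
  simp only [mul_smul_comm, smul_mul_assoc]
  module

theorem rescale_eigenvalue_ne_zero [CharZero K] (m n : ℕ) :
    (2 : K) ^ m * 2 ^ n - 2 + 0 ^ n + 0 ^ m - 2 * (0 ^ m * 0 ^ n) ≠ 0 := by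
  have key (k : ℕ) : (2 : K) ^ (k + 1) - 1 ≠ 0 := by
    rw [sub_ne_zero]
    have : 2 ^ (k + 1) ≠ 1 := by simp
    exact_mod_cast this
  rcases m with - | m <;> rcases n with - | n
  · norm_num
  · convert key n using 1
    simp; ring
  · convert key m using 1
    simp; ring
  · have := mul_ne_zero (two_ne_zero (α := K)) (key (m + n))
    convert this using 1
    simp; ring

/-- A linear map which is diagonal with nonzero eigenvalues in some basis is bijective. -/
theorem bijective_of_diagonal {E I : Type} [AddCommGroup E] [Module K E] (b : Module.Basis I K E)
    (R : E →ₗ[K] E) (c : I → K) (hc : ∀ i, c i ≠ 0) (h : ∀ i, R (b i) = c i • b i) :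
    Function.Bijective R := by
  let S : E →ₗ[K] E := b.constr K fun i => (c i)⁻¹ • b i
  have h₁ : S ∘ₗ R = LinearMap.id := b.ext fun i => by simp [S, h, smul_smul, hc]
  have h₂ : R ∘ₗ S = LinearMap.id := b.ext fun i => by simp [S, h, smul_smul, hc]
  exact ⟨Function.LeftInverse.injective (g := S) (LinearMap.congr_fun h₁),
    fun x => ⟨S x, LinearMap.congr_fun h₂ x⟩⟩

theorem rescale_bijective [CharZero K] : Function.Bijective (rescale K ι) :=
  bijective_of_diagonal ((basisMonomials ι K).tensorProduct (basisMonomials ι K)) _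
    (fun i => _) (fun i => rescale_eigenvalue_ne_zero i.1.degree i.2.degree) fun i => by
      simp [Module.Basis.tensorProduct_apply', rescale_monomial]

theorem coboundary_X (i : ι) : coboundary K ι (X i) = 0 := by
  simp [coboundary_apply]

theorem rescale₁_monomial (α : ι →₀ ℕ) (a : K) :
    rescale₁ K ι (monomial α a) = ((2 : K) ^ α.degree - 2) • monomial α a := by
  have := map_monomial_of_smul (AlgHom.id K (MvPolynomial ι K))
    (aeval fun i => (2 : K) • (X i : MvPolynomial ι K)) 2 (by simp) α a
  simp only [AlgHom.id_apply] at this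
  rw [rescale₁, sub_smul, ← this]
  rfl

theorem coeff_rescale₁ (α : ι →₀ ℕ) (p : MvPolynomial ι K) :
    coeff α (rescale₁ K ι p) = ((2 : K) ^ α.degree - 2) * coeff α p := by
  classical
  induction p using MvPolynomial.induction_on' with
  | monomial β a =>
    rw [rescale₁_monomial, coeff_smul, smul_eq_mul, coeff_monomial]
    split_ifs with h
    · rw [h]
    · simp
  | add p r hp hr => rw [map_add, coeff_add, coeff_add, hp, hr, mul_add]

theorem two_pow_sub_two_ne_zero [CharZero K] {n : ℕ} (hn : n ≠ 1) : (2 : K) ^ n - 2 ≠ 0 := by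
  rw [sub_ne_zero]
  have : 2 ^ n ≠ 2 ^ 1 := fun h => hn (Nat.pow_right_injective le_rfl h)
  exact_mod_cast this

theorem rescale₁_eq_zero {p : MvPolynomial ι K} (hp : coboundary K ι p = 0) :
    rescale₁ K ι p = 0 := by
  have h (s t : K) : (Algebra.TensorProduct.lmul' K).comp (ev K ι s t) =
      aeval fun i => (s + t) • (X i : MvPolynomial ι K) := by
    ext i
    simp [add_smul]
  have h' := congrArg (Algebra.TensorProduct.lmul' K) hp
  rw [coboundary_apply, map_sub, map_sub, ← AlgHom.comp_apply, ← AlgHom.comp_apply,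
    ← AlgHom.comp_apply, h, h, h, map_zero] at h'
  norm_num at h'
  rw [← h', rescale₁]
  simp only [LinearMap.sub_apply, AlgHom.toLinearMap_apply, two_smul]
  simp [sub_sub, ← two_smul K]

theorem exists_coboundary_rescale₁ [CharZero K] (p : MvPolynomial ι K) :
    ∃ p', coboundary K ι (rescale₁ K ι p') = coboundary K ι p := by
  let S := LinearMap.range (coboundary K ι ∘ₗ rescale₁ K ι)
  suffices p ∈ S.comap (coboundary K ι) from this
  rw [p.as_sum]
  refine Submodule.sum_mem _ fun α _ => ?_
  by_cases hα : α.degree = 1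
  · obtain ⟨i, rfl⟩ : ∃ i, α = Finsupp.single i 1 := by
      exact (Finsupp.sum_eq_one_iff α).mp hα
    have : (monomial (Finsupp.single i 1) (coeff (Finsupp.single i 1) p) : MvPolynomial ι K) =
        coeff (Finsupp.single i 1) p • X i := by
      simp [X, smul_monomial]
    rw [this]
    exact ⟨0, by simp [coboundary_X]⟩
  · refine ⟨((2 : K) ^ α.degree - 2)⁻¹ • monomial α (coeff α p), ?_⟩
    rw [map_smul, LinearMap.comp_apply, rescale₁_monomial, map_smul, smul_smul,
      inv_mul_cancel₀ (two_pow_sub_two_ne_zero hα), one_smul]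

end

section

variable {V ι : Type} [AddCommGroup V] [Module K V] (b : Module.Basis ι K V)


/-- The linear form attached to a vector. -/
noncomputable def lin : V →ₗ[K] MvPolynomial ι K := b.constr K X

@[simp] theorem lin_basis (i : ι) : lin b (b i) = X i :=
  b.constr_basis K X i

@[simp] theorem constantCoeff_lin (v : V) : constantCoeff (lin b v) = 0 := by
  have : (lcoeff K 0 : MvPolynomial ι K →ₗ[K] K) ∘ₗ lin b = 0 := b.ext fun i => by
    simp
  exact LinearMap.congr_fun this v

theorem coboundary_lin (v : V) : coboundary K ι (lin b v) = 0 := by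
  have : coboundary K ι ∘ₗ lin b = 0 := b.ext fun i => by
    simp [coboundary_X]
  exact LinearMap.congr_fun this v

/-- The derivation of the polynomial ring induced by an endomorphism. -/
noncomputable def der (A : V →ₗ[K] V) : Derivation K (MvPolynomial ι K) (MvPolynomial ι K) :=
  mkDerivation K fun i => lin b (A (b i))

theorem der_lin (A : V →ₗ[K] V) (v : V) : der b A (lin b v) = lin b (A v) := by
  have : (der b A : MvPolynomial ι K →ₗ[K] MvPolynomial ι K) ∘ₗ lin b = lin b ∘ₗ A :=
    b.ext fun i => by simp [der, mkDerivation_X]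
  exact LinearMap.congr_fun this v

theorem der_X (A : V →ₗ[K] V) (i : ι) : der b A (X i) = lin b (A (b i)) := by
  simp [der, mkDerivation_X]

@[simp] theorem constantCoeff_der (A : V →ₗ[K] V) (p : MvPolynomial ι K) :
    constantCoeff (der b A p) = 0 := by
  induction p using MvPolynomial.induction_on with
  | C a => simp
  | add r s hr hs => simp [hr, hs]
  | mul_X r j h => simp [der_X, h]

variable [Fintype ι]

/-- The linear part of a polynomial. -/
noncomputable def linPart : MvPolynomial ι K →ₗ[K] V :=
  ∑ i, (lcoeff K (Finsupp.single i 1)).smulRight (b i)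

theorem linPart_apply (p : MvPolynomial ι K) :
    linPart b p = ∑ i, coeff (Finsupp.single i 1) p • b i := by
  simp [linPart]

@[simp] theorem linPart_C (a : K) : linPart b (C a) = 0 := by
  classical
  rw [linPart_apply]
  refine Finset.sum_eq_zero fun i _ => ?_
  rw [coeff_C, if_neg (by simp [eq_comm]), zero_smul]

@[simp] theorem linPart_one : linPart b 1 = 0 := linPart_C b 1

@[simp] theorem linPart_mul_X (p : MvPolynomial ι K) (j : ι) :
    linPart b (p * X j) = constantCoeff p • b j := by
  classical
  rw [linPart_apply, Finset.sum_eq_single j]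
  · simp [coeff_mul_X', constantCoeff_eq]
  · intro i _ hij
    rw [coeff_mul_X', if_neg (by simp [hij.symm]), zero_smul]
  · simp

@[simp] theorem linPart_X (j : ι) : linPart b (X j) = b j := by
  simpa using linPart_mul_X b 1 j

@[simp] theorem linPart_mul (p r : MvPolynomial ι K) :
    linPart b (p * r) = constantCoeff p • linPart b r + constantCoeff r • linPart b p := by
  induction r using MvPolynomial.induction_on with
  | C a => simp [mul_comm p, ← smul_eq_C_mul]
  | add r s hr hs =>
    simp only [mul_add, map_add, hr, hs, smul_add, add_smul]
    abel
  | mul_X r j _ => simp [← mul_assoc, mul_smul]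

@[simp] theorem linPart_lin (v : V) : linPart b (lin b v) = v := by
  have : linPart b ∘ₗ lin b = LinearMap.id := b.ext fun i => by simp
  exact LinearMap.congr_fun this v

theorem eq_lin_of_coboundary_eq_zero [CharZero K] {p : MvPolynomial ι K}
    (hp : coboundary K ι p = 0) : p = lin b (linPart b p) := by
  classical
  have h (α : ι →₀ ℕ) : coeff α (lin b (linPart b p)) =
      ∑ i, coeff (Finsupp.single i 1) p * coeff α (X i : MvPolynomial ι K) := by
    simp [linPart_apply, coeff_sum]
  ext α
  rw [h]
  by_cases hα : α.degree = 1
  · obtain ⟨j, rfl⟩ : ∃ i, α = Finsupp.single i 1 := (Finsupp.sum_eq_one_iff α).mp hα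
    simp [coeff_X, Finsupp.single_left_inj]
  · have h' := coeff_rescale₁ α p
    rw [rescale₁_eq_zero hp, coeff_zero, eq_comm, mul_eq_zero,
      or_iff_right (two_pow_sub_two_ne_zero hα)] at h'
    rw [h', eq_comm]
    refine Finset.sum_eq_zero fun i _ => ?_
    rw [coeff_X, if_neg, mul_zero]
    rintro rfl
    simp at hα

@[simp] theorem linPart_der (A : V →ₗ[K] V) (p : MvPolynomial ι K) :
    linPart b (der b A p) = A (linPart b p) := by
  induction p using MvPolynomial.induction_on with
  | C a => simp
  | add r s hr hs => simp [hr, hs]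
  | mul_X r j h => simp [der_X]

end

end PolyModel

/-! ### The model DG-Lie algebra of polynomials -/

namespace PolyModel

open MvPolynomial TensorProduct

section

variable {V ι : Type} [AddCommGroup V] [Module K V] (b : Module.Basis ι K V)

theorem der_add (A A' : V →ₗ[K] V) (p : MvPolynomial ι K) :
    der b (A + A') p = der b A p + der b A' p := by
  have : der b (A + A') = der b A + der b A' := derivation_ext fun i => by simp [der_X]
  rw [this]
  rfl

theorem der_smul (c : K) (A : V →ₗ[K] V) (p : MvPolynomial ι K) :
    der b (c • A) p = c • der b A p := by
  have : der b (c • A) = c • der b A := derivation_ext fun i => by simp [der_X]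
  rw [this]
  rfl

theorem der_der {A A' A'' : V →ₗ[K] V} (h : ∀ v, A (A' v) = A'' v + A' (A v))
    (p : MvPolynomial ι K) : der b A (der b A' p) = der b A'' p + der b A' (der b A p) := by
  induction p using MvPolynomial.induction_on with
  | C a => simp
  | add p r hp hr => simp only [map_add, hp, hr]; abel
  | mul_X p j hp =>
    have : der b A (der b A' (X j)) = der b A'' (X j) + der b A' (der b A (X j)) := by
      simp only [der_X, der_lin, h, map_add]
    simp only [Derivation.leibniz, smul_eq_mul, map_add, hp, this]
    ring

/-- The action of an endomorphism on polynomials in two sets of variables. -/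
noncomputable def der₂ (A : V →ₗ[K] V) :
    MvPolynomial ι K ⊗[K] MvPolynomial ι K →ₗ[K] MvPolynomial ι K ⊗[K] MvPolynomial ι K :=
  TensorProduct.map (der b A) LinearMap.id + TensorProduct.map LinearMap.id (der b A)

@[simp] theorem der₂_tmul (A : V →ₗ[K] V) (p r : MvPolynomial ι K) :
    der₂ b A (p ⊗ₜ[K] r) = der b A p ⊗ₜ[K] r + p ⊗ₜ[K] der b A r := rfl

theorem der₂_mul (A : V →ₗ[K] V) (f g : MvPolynomial ι K ⊗[K] MvPolynomial ι K) :
    der₂ b A (f * g) = f * der₂ b A g + der₂ b A f * g := by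
  induction f using TensorProduct.induction_on with
  | zero => simp
  | add f f' hf hf' => simp only [add_mul, map_add, hf, hf']; abel
  | tmul p r =>
    induction g using TensorProduct.induction_on with
    | zero => simp
    | add g g' hg hg' => simp only [mul_add, map_add, hg, hg']; abel
    | tmul p' r' =>
      simp only [Algebra.TensorProduct.tmul_mul_tmul, der₂_tmul, Derivation.leibniz, smul_eq_mul,
        tmul_add, add_tmul, mul_add, add_mul]
      rw [mul_comm p' (der b A p), mul_comm r' (der b A r)]
      abel

theorem ev_lin (s t : K) (v : V) :
    ev K ι s t (lin b v) = s • (lin b v ⊗ₜ[K] 1) + t • (1 ⊗ₜ[K] lin b v) := by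
  have : (ev K ι s t).toLinearMap ∘ₗ lin b = s • (TensorProduct.mk K _ _).flip 1 ∘ₗ lin b +
      t • TensorProduct.mk K _ _ 1 ∘ₗ lin b := b.ext fun i => by simp
  exact LinearMap.congr_fun this v

theorem der₂_ev (A : V →ₗ[K] V) (s t : K) (p : MvPolynomial ι K) :
    der₂ b A (ev K ι s t p) = ev K ι s t (der b A p) := by
  induction p using MvPolynomial.induction_on with
  | C a => simp [ev, Algebra.TensorProduct.algebraMap_apply]
  | add p r hp hr => simp only [map_add, hp, hr]
  | mul_X p j hp => simp [der₂_mul, hp, ev_lin, der_X, mul_comm, add_comm]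

theorem der₂_ev₂ (A : V →ₗ[K] V) (s t s' t' : K) (f : MvPolynomial ι K ⊗[K] MvPolynomial ι K) :
    der₂ b A (ev₂ K ι s t s' t' f) = ev₂ K ι s t s' t' (der₂ b A f) := by
  induction f using TensorProduct.induction_on with
  | zero => simp
  | add f f' hf hf' => simp only [map_add, hf, hf']
  | tmul p r => simp [der₂_mul, der₂_ev, add_comm]

theorem der₂_coboundary (A : V →ₗ[K] V) (p : MvPolynomial ι K) :
    der₂ b A (coboundary K ι p) = coboundary K ι (der b A p) := by
  simp only [coboundary_apply, map_sub, der₂_ev]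

theorem der₂_rescale (A : V →ₗ[K] V) (f : MvPolynomial ι K ⊗[K] MvPolynomial ι K) :
    der₂ b A (rescale K ι f) = rescale K ι (der₂ b A f) := by
  simp only [rescale_apply, map_sub, map_add, map_smul, der₂_ev₂]

theorem der₂_der₂ {A A' A'' : V →ₗ[K] V} (h : ∀ v, A (A' v) = A'' v + A' (A v))
    (f : MvPolynomial ι K ⊗[K] MvPolynomial ι K) :
    der₂ b A (der₂ b A' f) = der₂ b A'' f + der₂ b A' (der₂ b A f) := by
  induction f using TensorProduct.induction_on with
  | zero => simp
  | add f f' hf hf' => simp only [map_add, hf, hf']; abel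
  | tmul p r =>
    simp only [der₂_tmul, map_add, der_der b h, add_tmul, tmul_add]
    abel

/-- The bilinear expression `a(s x + t y) f(w, z) - f(x', y') a(z)` in `a` and `f`. -/
noncomputable def cochain (K ι : Type) [Field K] (x₁ x₂ y₁ y₂ z₁ z₂ : K) :
    MvPolynomial ι K →ₗ[K] MvPolynomial ι K ⊗[K] MvPolynomial ι K →ₗ[K]
      MvPolynomial ι K ⊗[K] MvPolynomial ι K :=
  LinearMap.mk₂ K (fun a f => ev K ι x₁ x₂ a * ev₂ K ι y₁ y₂ z₁ z₂ f -
      ev K ι z₁ z₂ a * ev₂ K ι x₁ x₂ y₁ y₂ f)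
    (fun a a' f => by simp only [map_add]; ring)
    (fun c a f => by simp only [map_smul, smul_mul_assoc, smul_sub])
    (fun a f f' => by simp only [map_add]; ring)
    (fun c a f => by simp only [map_smul, mul_smul_comm, smul_sub])

theorem cochain_apply (x₁ x₂ y₁ y₂ z₁ z₂ : K) (a : MvPolynomial ι K)
    (f : MvPolynomial ι K ⊗[K] MvPolynomial ι K) :
    cochain K ι x₁ x₂ y₁ y₂ z₁ z₂ a f = ev K ι x₁ x₂ a * ev₂ K ι y₁ y₂ z₁ z₂ f -
      ev K ι z₁ z₂ a * ev₂ K ι x₁ x₂ y₁ y₂ f := rfl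

/-- The bracket of degree one and degree two elements in the model, before passing to the
quotient. -/
noncomputable def preBracket (K ι : Type) [Field K] :
    MvPolynomial ι K →ₗ[K] MvPolynomial ι K ⊗[K] MvPolynomial ι K →ₗ[K]
      MvPolynomial ι K ⊗[K] MvPolynomial ι K :=
  LinearMap.mk₂ K (fun a f => cochain K ι 1 0 1 0 0 2 a f - cochain K ι 1 0 0 1 1 1 a f -
      cochain K ι 1 0 0 1 0 1 a f + cochain K ι 1 0 0 0 0 0 a f + cochain K ι 0 1 0 0 0 0 a f)
    (fun a a' f => by simp only [map_add, LinearMap.add_apply]; ring)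
    (fun c a f => by simp only [map_smul, LinearMap.smul_apply, smul_sub, smul_add])
    (fun a f f' => by simp only [map_add]; ring)
    (fun c a f => by simp only [map_smul, smul_sub, smul_add])

theorem preBracket_apply (a : MvPolynomial ι K) (f : MvPolynomial ι K ⊗[K] MvPolynomial ι K) :
    preBracket K ι a f = cochain K ι 1 0 1 0 0 2 a f - cochain K ι 1 0 0 1 1 1 a f -
      cochain K ι 1 0 0 1 0 1 a f + cochain K ι 1 0 0 0 0 0 a f + cochain K ι 0 1 0 0 0 0 a f := rfl

theorem der₂_preBracket (A : V →ₗ[K] V) (a : MvPolynomial ι K)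
    (f : MvPolynomial ι K ⊗[K] MvPolynomial ι K) :
    der₂ b A (preBracket K ι a f) = preBracket K ι (der b A a) f + preBracket K ι a (der₂ b A f) := by
  simp only [preBracket_apply, cochain_apply, map_sub, map_add, der₂_mul, der₂_ev, der₂_ev₂]
  ring

/-- The symmetric product of polynomials. -/
noncomputable def symProd (K ι : Type) [Field K] :
    MvPolynomial ι K →ₗ[K] MvPolynomial ι K →ₗ[K] MvPolynomial ι K ⊗[K] MvPolynomial ι K :=
  TensorProduct.mk K _ _ + (TensorProduct.mk K _ _).flip

theorem symProd_apply (a c : MvPolynomial ι K) :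
    symProd K ι a c = a ⊗ₜ[K] c + c ⊗ₜ[K] a := rfl

theorem preBracket_jacobi (a a' a'' : MvPolynomial ι K) :
    preBracket K ι a (symProd K ι a' a'') + preBracket K ι a' (symProd K ι a'' a) +
      preBracket K ι a'' (symProd K ι a a') = 0 := by
  simp only [preBracket_apply, cochain_apply, symProd_apply, map_add, ev₂_tmul]
  ring

theorem rescale_symProd (a a' : MvPolynomial ι K) :
    rescale K ι (symProd K ι a a') + preBracket K ι a (coboundary K ι a') +
      preBracket K ι a' (coboundary K ι a) = coboundary K ι (2 * (a * a')) := by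
  simp only [preBracket_apply, cochain_apply, symProd_apply, map_add, ev₂_tmul, rescale_apply,
    coboundary_apply, map_sub, ev₂_ev, map_mul, map_ofNat]
  norm_num
  simp only [two_smul]
  ring

end

end PolyModel

/-- A graded Lie algebra in degrees `0, 1, 2`. -/
structure QuadData (K : Type) [Field K] (G V W : Type) [AddCommGroup G] [Module K G]
    [AddCommGroup V] [Module K V] [AddCommGroup W] [Module K W] where
  lie : G →ₗ[K] G →ₗ[K] G
  aV : G →ₗ[K] V →ₗ[K] V
  aW : G →ₗ[K] W →ₗ[K] W
  q : V →ₗ[K] V →ₗ[K] W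
  lie_skew : ∀ x y, lie x y = -lie y x
  lie_jacobi : ∀ x y z, lie x (lie y z) = lie (lie x y) z + lie y (lie x z)
  aV_lie : ∀ x y p, aV x (aV y p) = aV (lie x y) p + aV y (aV x p)
  aW_lie : ∀ x y p, aW x (aW y p) = aW (lie x y) p + aW y (aW x p)
  q_symm : ∀ a b, q a b = q b a
  aW_q : ∀ x a b, aW x (q a b) = q (aV x a) b + q a (aV x b)

namespace QuadData

open MvPolynomial TensorProduct PolyModel

variable {G V W ι : Type} [AddCommGroup G] [Module K G]
    [AddCommGroup V] [Module K V] [AddCommGroup W] [Module K W]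

/-- The four-term structure with zero differential. -/
def minimal (Q : QuadData K G V W) : FourTerm K G V W PUnit.{1} where
  lie := Q.lie
  a₁ := Q.aV
  a₂ := Q.aW
  a₃ := 0
  q := Q.q
  t := 0
  d₁ := 0
  d₂ := 0
  lie_skew := Q.lie_skew
  lie_jacobi := Q.lie_jacobi
  a₁_lie := Q.aV_lie
  a₂_lie := Q.aW_lie
  a₃_lie _ _ _ := rfl
  q_symm := Q.q_symm
  a₂_q := Q.aW_q
  a₃_t _ _ _ := rfl
  t_jacobi _ _ _ := rfl
  d₁_a _ _ := by simp
  d₂_a _ _ := rfl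
  d_d _ := rfl
  d₂_q _ _ := rfl

/-- The action of the degree zero part on polynomials. -/
noncomputable def act₁ (Q : QuadData K G V W) (b : Module.Basis ι K V) :
    G →ₗ[K] MvPolynomial ι K →ₗ[K] MvPolynomial ι K :=
  LinearMap.mk₂ K (fun x p => der b (Q.aV x) p) (fun x y p => by rw [map_add, der_add])
    (fun c x p => by rw [map_smul, der_smul]) (fun x p r => map_add _ _ _)
    (fun c x p => Derivation.map_smul _ _ _)

@[simp] theorem act₁_apply (Q : QuadData K G V W) (b : Module.Basis ι K V) (x : G)
    (p : MvPolynomial ι K) : Q.act₁ b x p = der b (Q.aV x) p := rfl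

/-- The action of the degree zero part on polynomials in two sets of variables. -/
noncomputable def act₂ (Q : QuadData K G V W) (b : Module.Basis ι K V) :
    G →ₗ[K] MvPolynomial ι K ⊗[K] MvPolynomial ι K →ₗ[K] MvPolynomial ι K ⊗[K] MvPolynomial ι K :=
  (LinearMap.rTensorHom _) ∘ₗ Q.act₁ b + (LinearMap.lTensorHom _) ∘ₗ Q.act₁ b

@[simp] theorem act₂_apply (Q : QuadData K G V W) (b : Module.Basis ι K V) (x : G)
    (f : MvPolynomial ι K ⊗[K] MvPolynomial ι K) : Q.act₂ b x f = der₂ b (Q.aV x) f := rfl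

/-- The action of the degree zero part on the top degree of the polynomial model. -/
noncomputable def act₃ (Q : QuadData K G V W) (b : Module.Basis ι K V) :
    G →ₗ[K] (MvPolynomial ι K ⊗[K] MvPolynomial ι K) ⧸ LinearMap.range (coboundary K ι) →ₗ[K]
      (MvPolynomial ι K ⊗[K] MvPolynomial ι K) ⧸ LinearMap.range (coboundary K ι) where
  toFun x := Submodule.mapQ _ _ (Q.act₂ b x) (by
    rintro _ ⟨p, rfl⟩
    exact ⟨der b (Q.aV x) p, (der₂_coboundary b _ p).symm⟩)
  map_add' x y := by ext f; simp
  map_smul' c x := by ext f; simp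

variable [Fintype ι]

/-- The polynomial model of a graded Lie algebra in degrees `0, 1, 2`. -/
noncomputable def poly (Q : QuadData K G V W) (b : Module.Basis ι K V) :
    FourTerm K G (MvPolynomial ι K) ((MvPolynomial ι K ⊗[K] MvPolynomial ι K) × W)
      ((MvPolynomial ι K ⊗[K] MvPolynomial ι K) ⧸ LinearMap.range (coboundary K ι)) where
  lie := Q.lie
  a₁ := Q.act₁ b
  a₂ := LinearMap.mk₂ K (fun x f => (Q.act₂ b x f.1, Q.aW x f.2)) (by simp) (by simp) (by simp)
    (by simp)
  a₃ := Q.act₃ b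
  q := LinearMap.mk₂ K (fun a c => (symProd K ι a c, Q.q (linPart b a) (linPart b c))) (by simp)
    (by simp) (by simp) (by simp)
  t := (preBracket K ι).compr₂ (Submodule.mkQ _) |>.compl₂ (LinearMap.fst K _ W)
  d₁ := LinearMap.inl K _ _ ∘ₗ coboundary K ι
  d₂ := Submodule.mkQ _ ∘ₗ rescale K ι ∘ₗ LinearMap.fst K _ _
  lie_skew := Q.lie_skew
  lie_jacobi := Q.lie_jacobi
  a₁_lie x y p := der_der b (Q.aV_lie x y) p
  a₂_lie x y p := Prod.ext (der₂_der₂ b (Q.aV_lie x y) p.1) (Q.aW_lie x y p.2)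
  a₃_lie x y p := by
    obtain ⟨f, rfl⟩ := Submodule.Quotient.mk_surjective _ p
    exact congrArg Submodule.Quotient.mk (der₂_der₂ b (Q.aV_lie x y) f)
  q_symm a c := by
    simp only [LinearMap.mk₂_apply]
    rw [Q.q_symm, symProd_apply, symProd_apply, add_comm]
  a₂_q x a c := by
    simp only [LinearMap.mk₂_apply, act₂_apply, act₁_apply, symProd_apply, map_add, der₂_tmul,
      linPart_der, Q.aW_q, Prod.mk_add_mk, Prod.mk.injEq, and_true]
    abel
  a₃_t x a f := congrArg Submodule.Quotient.mk (der₂_preBracket b (Q.aV x) a f.1)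
  t_jacobi a a' a'' := congrArg Submodule.Quotient.mk (preBracket_jacobi a a' a'')
  d₁_a x p := Prod.ext (der₂_coboundary b _ p).symm (map_zero _).symm
  d₂_a x p := congrArg Submodule.Quotient.mk (der₂_rescale b _ p.1).symm
  d_d p := (Submodule.Quotient.mk_eq_zero _).2 ⟨_, (rescale_coboundary p).symm⟩
  d₂_q a c := by
    rw [← sub_eq_zero]
    refine Eq.trans ?_ ((Submodule.Quotient.mk_eq_zero _).2 ⟨_, (rescale_symProd a c).symm⟩)
    simp
    abel

theorem poly_d₁_lin (Q : QuadData K G V W) (b : Module.Basis ι K V) (v : V) :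
    (Q.poly b).d₁ (lin b v) = 0 :=
  Prod.ext (coboundary_lin b v) rfl

variable [CharZero K]

theorem poly_d₂_surjective (Q : QuadData K G V W) (b : Module.Basis ι K V) :
    Function.Surjective (Q.poly b).d₂ := by
  intro s
  obtain ⟨f, rfl⟩ := Submodule.Quotient.mk_surjective _ s
  obtain ⟨g, rfl⟩ := rescale_bijective.2 f
  exact ⟨(g, 0), rfl⟩

theorem exists_of_poly_d₂_eq_zero (Q : QuadData K G V W) (b : Module.Basis ι K V)
    {f : (MvPolynomial ι K ⊗[K] MvPolynomial ι K) × W} (hf : (Q.poly b).d₂ f = 0) :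
    ∃ p, coboundary K ι p = f.1 := by
  obtain ⟨p, hp⟩ := (Submodule.Quotient.mk_eq_zero _).1 hf
  obtain ⟨p', hp'⟩ := exists_coboundary_rescale₁ p
  exact ⟨p', rescale_bijective.1 (by rw [rescale_coboundary, hp', hp]; rfl)⟩

theorem eq_lin_of_poly_d₁_eq_zero (Q : QuadData K G V W) (b : Module.Basis ι K V)
    {p : MvPolynomial ι K} (hp : (Q.poly b).d₁ p = 0) : p = lin b (linPart b p) :=
  eq_lin_of_coboundary_eq_zero b (congrArg Prod.fst hp)

/-- The projection of the polynomial model to the graded Lie algebra. -/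
noncomputable def polyToMinimal (Q : QuadData K G V W) (b : Module.Basis ι K V) :
    FourTerm.Hom (Q.poly b) Q.minimal where
  f₁ := linPart b
  f₂ := LinearMap.snd K _ _
  f₃ := 0
  lie_eq := rfl
  map_a₁ _ p := linPart_der b _ p
  map_a₂ _ _ := rfl
  map_a₃ _ _ := rfl
  map_q _ _ := rfl
  map_t _ _ := rfl
  map_d₁ _ := rfl
  map_d₂ _ := rfl

theorem poly_qIso_minimal (Q : QuadData K G V W) (b : Module.Basis ι K V) :
    QIso (Q.poly b).toDGLA Q.minimal.toDGLA := by
  refine (Q.polyToMinimal b).qIso (fun a h h' => ?_) (fun v _ => ?_) (fun f _ h h' => ?_)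
    (fun w _ => ?_) (Q.poly_d₂_surjective b) (fun _ => ⟨0, rfl⟩)
  · rw [Q.eq_lin_of_poly_d₁_eq_zero b h, show linPart b a = 0 from h', map_zero]
  · exact ⟨lin b v, Q.poly_d₁_lin b v, linPart_lin b v⟩
  · obtain ⟨p, hp⟩ := Q.exists_of_poly_d₂_eq_zero b h
    exact ⟨p, Prod.ext hp h'⟩
  · exact ⟨(0, w), 0, map_zero ((Q.poly b).d₂ ∘ₗ LinearMap.inl K _ _), (sub_self w).symm⟩

end QuadData

/-! ### Homogeneity and linear maps on polynomials -/

namespace PolyModel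

open MvPolynomial TensorProduct

section

variable {V ι : Type} [AddCommGroup V] [Module K V]

theorem coord_of_diagonal {E I : Type} [AddCommGroup E] [Module K E] (b : Module.Basis I K E)
    (R : E →ₗ[K] E) (c : I → K) (h : ∀ i, R (b i) = c i • b i) (x : E) (i : I) :
    b.repr (R x) i = c i * b.repr x i := by
  classical
  have : b.coord i ∘ₗ R = c i • b.coord i := b.ext fun j => by
    by_cases hij : j = i
    · simp [h, hij]
    · simp [h, hij]
  exact LinearMap.congr_fun this x

/-- If `f` is homogeneous of total degree `n`, the value of a bilinear map on `f` depends only on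
its values on pairs of monomials of total degree `n`. -/
theorem lift_eq_of_homogeneous [CharZero K] {E : Type} [AddCommGroup E] [Module K E]
    {B B' : MvPolynomial ι K →ₗ[K] MvPolynomial ι K →ₗ[K] E} {n : ℕ}
    (h : ∀ α β : ι →₀ ℕ, α.degree + β.degree = n →
      B (monomial α 1) (monomial β 1) = B' (monomial α 1) (monomial β 1))
    {f : MvPolynomial ι K ⊗[K] MvPolynomial ι K} (hf : ev₂ K ι 2 0 0 2 f = (2 : K) ^ n • f) :
    lift B f = lift B' f := by
  let b := (basisMonomials ι K).tensorProduct (basisMonomials ι K)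
  have hb (i : (ι →₀ ℕ) × (ι →₀ ℕ)) : b i = monomial i.1 1 ⊗ₜ[K] monomial i.2 1 := by
    simp [b, Module.Basis.tensorProduct_apply']
  have hd (i : (ι →₀ ℕ) × (ι →₀ ℕ)) : (ev₂ K ι 2 0 0 2).toLinearMap (b i) =
      ((2 : K) ^ (i.1.degree + i.2.degree)) • b i := by
    rw [hb, AlgHom.toLinearMap_apply, ev₂_tmul,
      map_monomial_of_smul (ev K ι 1 0) (ev K ι 2 0) 2 (by simp),
      map_monomial_of_smul (ev K ι 0 1) (ev K ι 0 2) 2 (by simp), tmul_eq_mul, smul_mul_smul_comm,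
      pow_add]
  have hc (i : (ι →₀ ℕ) × (ι →₀ ℕ)) (hi : i.1.degree + i.2.degree ≠ n) : b.repr f i = 0 := by
    have := coord_of_diagonal b _ _ hd f i
    rw [AlgHom.toLinearMap_apply, hf, map_smul, Finsupp.smul_apply, smul_eq_mul,
      mul_eq_mul_right_iff] at this
    refine this.resolve_left fun h => hi ?_
    exact (Nat.pow_right_injective le_rfl (by exact_mod_cast h)).symm
  rw [← b.linearCombination_repr f, Finsupp.linearCombination_apply, Finsupp.sum, map_sum, map_sum]
  refine Finset.sum_congr rfl fun i _ => ?_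
  by_cases hi : i.1.degree + i.2.degree = n
  · rw [map_smul, map_smul, hb, lift.tmul, lift.tmul, h _ _ hi]
  · rw [hc i hi, zero_smul, map_zero, map_zero]

theorem ev_monomial_homogeneous (α : ι →₀ ℕ) (a : K) :
    ev₂ K ι 2 0 0 2 (ev K ι 1 1 (monomial α a)) = (2 : K) ^ α.degree • ev K ι 1 1 (monomial α a) := by
  rw [ev₂_ev]
  exact map_monomial_of_smul _ _ 2 (fun i => by simp) α a

/-- Two linear maps agree on all monomials of degree at most `n`. -/
def Agree {E : Type} [AddCommGroup E] [Module K E] (n : ℕ) (y y' : MvPolynomial ι K →ₗ[K] E) :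
    Prop :=
  ∀ α : ι →₀ ℕ, α.degree ≤ n → y (monomial α 1) = y' (monomial α 1)

variable {E : Type} [AddCommGroup E] [Module K E]

/-- An operator improving the degree of agreement has a fixed point. -/
theorem exists_fixed_point (F : (MvPolynomial ι K →ₗ[K] E) → (MvPolynomial ι K →ₗ[K] E))
    (h₁ : ∀ y, Agree 1 y 0 → Agree 1 (F y) 0)
    (h₂ : ∀ n y y', Agree 1 y 0 → Agree 1 y' 0 → Agree n y y' → Agree (n + 1) (F y) (F y')) :
    ∃ y, F y = y ∧ Agree 1 y 0 ∧ ∀ n, Agree n y (F^[n] 0) := by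
  have hY (n : ℕ) : Agree 1 (F^[n] 0) 0 := by
    induction n with
    | zero => exact fun _ _ => rfl
    | succ n ih => rw [Function.iterate_succ_apply']; exact h₁ _ ih
  have hs (n : ℕ) : Agree (n + 1) (F^[n] 0) (F^[n + 1] 0) := by
    induction n with
    | zero => exact fun α hα => (hY 1 α hα).symm
    | succ n ih =>
      rw [Function.iterate_succ_apply' F n, Function.iterate_succ_apply' F (n + 1)]
      exact h₂ _ _ _ (hY _) (hY _) ih
  have hm (n m : ℕ) (hnm : n ≤ m) : Agree (n + 1) (F^[n] 0) (F^[m] 0) := by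
    induction m, hnm using Nat.le_induction with
    | base => exact fun _ _ => rfl
    | succ m hnm ih => exact fun α hα => (ih α hα).trans (hs m α (by omega))
  let y : MvPolynomial ι K →ₗ[K] E :=
    (basisMonomials ι K).constr K fun α => (F^[α.degree] 0) (monomial α 1)
  have hy (α : ι →₀ ℕ) : y (monomial α 1) = (F^[α.degree] 0) (monomial α 1) := by
    have := (basisMonomials ι K).constr_basis K
      (fun α : ι →₀ ℕ => (F^[α.degree] 0) (monomial α (1 : K))) α
    simpa using this
  have ha (n : ℕ) : Agree n y (F^[n] 0) := fun α hα => by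
    rw [hy]
    exact hm _ _ hα α (by omega)
  have h1 : Agree 1 y 0 := fun α hα => (ha 1 α hα).trans (hY 1 α hα)
  refine ⟨y, (basisMonomials ι K).ext fun α => ?_, h1, ha⟩
  rw [coe_basisMonomials]
  have := h₂ _ _ _ h1 (hY _) (ha α.degree) α (by omega)
  rw [this, ← Function.iterate_succ_apply' F, ha _ α (Nat.le_succ _)]

/-- A polynomial satisfying the scaling equation of homogeneous polynomials of degree `n`. -/
theorem Agree.eq_of_rescale₁ [CharZero K] {n : ℕ} {y y' : MvPolynomial ι K →ₗ[K] E}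
    (h : Agree n y y') {p : MvPolynomial ι K} (hp : rescale₁ K ι p = ((2 : K) ^ n - 2) • p) :
    y p = y' p := by
  rw [p.as_sum, map_sum, map_sum]
  refine Finset.sum_congr rfl fun α _ => ?_
  have hm : (monomial α (coeff α p) : MvPolynomial ι K) = coeff α p • monomial α 1 := by
    rw [smul_monomial, smul_eq_mul, mul_one]
  rw [hm, map_smul, map_smul]
  by_cases hα : α.degree ≤ n
  · rw [h α hα]
  · have := coeff_rescale₁ α p
    rw [hp, coeff_smul, smul_eq_mul, mul_eq_mul_right_iff, sub_left_inj] at this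
    rw [this.resolve_left fun h => hα ?_, zero_smul, zero_smul]
    exact (Nat.pow_right_injective le_rfl (by exact_mod_cast h)).ge

theorem der_rescale₁ (b : Module.Basis ι K V) (A : V →ₗ[K] V) (p : MvPolynomial ι K) :
    der b A (rescale₁ K ι p) = rescale₁ K ι (der b A p) := by
  set σ : MvPolynomial ι K →ₐ[K] MvPolynomial ι K :=
    aeval fun i => (2 : K) • (X i : MvPolynomial ι K) with hσ
  have hl (v : V) : σ (lin b v) = (2 : K) • lin b v := by
    have : σ.toLinearMap ∘ₗ lin b = (2 : K) • lin b := b.ext fun i => by simp [hσ]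
    exact LinearMap.congr_fun this v
  have key : der b A (σ p) = σ (der b A p) := by
    induction p using MvPolynomial.induction_on with
    | C a => simp [hσ, algebraMap_eq]
    | add p r hp hr => simp only [map_add, hp, hr]
    | mul_X p j hp =>
      have : σ (X j) = (2 : K) • X j := by simp [hσ]
      simp only [map_mul, Derivation.leibniz, smul_eq_mul, map_add, hp, this, der_X, hl,
        Derivation.map_smul]
  simp only [rescale₁, LinearMap.sub_apply, AlgHom.toLinearMap_apply, map_sub, LinearMap.smul_apply,
    LinearMap.id_apply, Derivation.map_smul]
  rw [← hσ, key]

theorem der_monomial_rescale₁ (b : Module.Basis ι K V) (A : V →ₗ[K] V) (α : ι →₀ ℕ) :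
    rescale₁ K ι (der b A (monomial α 1)) = ((2 : K) ^ α.degree - 2) • der b A (monomial α 1) := by
  rw [← der_rescale₁, rescale₁_monomial, Derivation.map_smul]

/-! ### Contractions of the coproduct -/

theorem lift_counit_right {B : MvPolynomial ι K →ₗ[K] MvPolynomial ι K →ₗ[K] E}
    {θ : MvPolynomial ι K →ₗ[K] E} (h : ∀ a r, B a r = constantCoeff r • θ a)
    (p : MvPolynomial ι K) : lift B (ev K ι 1 1 p) = θ p := by
  let ε : MvPolynomial ι K ⊗[K] MvPolynomial ι K →ₐ[K] MvPolynomial ι K :=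
    Algebra.TensorProduct.productMap (AlgHom.id K _) (aeval 0)
  have h₁ (f) : lift B f = θ (ε f) := by
    induction f using TensorProduct.induction_on with
    | zero => simp
    | add f g hf hg => rw [map_add, map_add, map_add, hf, hg]
    | tmul a r =>
      rw [lift.tmul, h, Algebra.TensorProduct.productMap_apply_tmul, aeval_zero,
        algebraMap_eq, AlgHom.id_apply, mul_comm, ← smul_eq_C_mul, map_smul]
  have h₂ : ε.comp (ev K ι 1 1) = AlgHom.id K _ := by
    ext i
    simp [ε]
  rw [h₁, ← AlgHom.comp_apply, h₂, AlgHom.id_apply]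

theorem lift_counit_left {B : MvPolynomial ι K →ₗ[K] MvPolynomial ι K →ₗ[K] E}
    {θ : MvPolynomial ι K →ₗ[K] E} (h : ∀ a r, B a r = constantCoeff a • θ r)
    (p : MvPolynomial ι K) : lift B (ev K ι 1 1 p) = θ p := by
  let ε : MvPolynomial ι K ⊗[K] MvPolynomial ι K →ₐ[K] MvPolynomial ι K :=
    Algebra.TensorProduct.productMap (aeval 0) (AlgHom.id K _)
  have h₁ (f) : lift B f = θ (ε f) := by
    induction f using TensorProduct.induction_on with
    | zero => simp
    | add f g hf hg => rw [map_add, map_add, map_add, hf, hg]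
    | tmul a r =>
      rw [lift.tmul, h, Algebra.TensorProduct.productMap_apply_tmul, aeval_zero,
        algebraMap_eq, AlgHom.id_apply, ← smul_eq_C_mul, map_smul]
  have h₂ : ε.comp (ev K ι 1 1) = AlgHom.id K _ := by
    ext i
    simp [ε]
  rw [h₁, ← AlgHom.comp_apply, h₂, AlgHom.id_apply]

theorem lTensor_der_mul (b : Module.Basis ι K V) (A : V →ₗ[K] V)
    (f g : MvPolynomial ι K ⊗[K] MvPolynomial ι K) :
    LinearMap.lTensor _ (der b A : MvPolynomial ι K →ₗ[K] MvPolynomial ι K) (f * g) =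
      f * LinearMap.lTensor _ (der b A : MvPolynomial ι K →ₗ[K] MvPolynomial ι K) g +
        LinearMap.lTensor _ (der b A : MvPolynomial ι K →ₗ[K] MvPolynomial ι K) f * g := by
  induction f using TensorProduct.induction_on with
  | zero => simp
  | add f f' hf hf' => simp only [add_mul, map_add, hf, hf']; abel
  | tmul p r =>
    induction g using TensorProduct.induction_on with
    | zero => simp
    | add g g' hg hg' => simp only [mul_add, map_add, hg, hg']; abel
    | tmul p' r' =>
      simp [Algebra.TensorProduct.tmul_mul_tmul, tmul_add, mul_comm r']

variable [Fintype ι]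

theorem lTensor_der_ev (b : Module.Basis ι K V) (A : V →ₗ[K] V) (p : MvPolynomial ι K) :
    LinearMap.lTensor _ (der b A : MvPolynomial ι K →ₗ[K] MvPolynomial ι K) (ev K ι 1 1 p) =
      ∑ i, ev K ι 1 1 (pderiv i p) * (1 ⊗ₜ[K] lin b (A (b i))) := by
  classical
  induction p using MvPolynomial.induction_on with
  | C a => simp [ev, Algebra.TensorProduct.algebraMap_apply]
  | add p r hp hr => simp only [map_add, hp, hr, add_mul, Finset.sum_add_distrib]
  | mul_X p j hp =>
    have : LinearMap.lTensor _ (der b A : MvPolynomial ι K →ₗ[K] MvPolynomial ι K)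
        (ev K ι 1 1 (X j)) = 1 ⊗ₜ[K] lin b (A (b j)) := by
      simp [der_X]
    rw [map_mul, lTensor_der_mul, hp, this, Finset.sum_mul]
    have h (i : ι) : ev K ι 1 1 (pderiv i (p * X j)) * (1 ⊗ₜ[K] lin b (A (b i))) =
        (if j = i then ev K ι 1 1 p * (1 ⊗ₜ[K] lin b (A (b i))) else 0) +
        ev K ι 1 1 (pderiv i p) * (1 ⊗ₜ[K] lin b (A (b i))) * ev K ι 1 1 (X j) := by
      rw [Derivation.leibniz, pderiv_X]
      by_cases hij : j = i
      · subst hij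
        simp only [Pi.single_eq_same, smul_eq_mul, map_add, map_mul, mul_one, if_true]
        ring
      · rw [Pi.single_eq_of_ne hij, if_neg hij]
        simp only [smul_eq_mul, map_add, map_mul, mul_zero, map_zero]
        ring
    simp only [h, Finset.sum_add_distrib, Finset.sum_ite_eq, Finset.mem_univ, if_true]

theorem sum_pderiv_mul (b : Module.Basis ι K V) (A : V →ₗ[K] V) (p : MvPolynomial ι K) :
    ∑ i, pderiv i p * lin b (A (b i)) = der b A p := by
  classical
  induction p using MvPolynomial.induction_on with
  | C a => simp
  | add p r hp hr => simp only [map_add, add_mul, Finset.sum_add_distrib, hp, hr]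
  | mul_X p j hp =>
    rw [Derivation.leibniz, ← hp, der_X, smul_eq_mul, smul_eq_mul, Finset.mul_sum]
    have h (i : ι) : pderiv i (p * X j) * lin b (A (b i)) =
        (if j = i then p * lin b (A (b i)) else 0) + X j * (pderiv i p * lin b (A (b i))) := by
      rw [Derivation.leibniz, pderiv_X]
      by_cases hij : j = i
      · subst hij
        simp only [Pi.single_eq_same, smul_eq_mul, mul_one, if_true]
        ring
      · rw [Pi.single_eq_of_ne hij, if_neg hij]
        simp only [smul_eq_mul, mul_zero]
        ring
    simp only [h, Finset.sum_add_distrib, Finset.sum_ite_eq, Finset.mem_univ, if_true]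

end

end PolyModel

/-! ### Twisting the polynomial model -/

/-- Structure maps of a DG-Lie algebra with degree one part `V × B`, degree two part `W × B` and
differential `(v, b) ↦ (0, b)`, together with the pairings coming from a cyclic structure. -/
structure TwistData (K : Type) [Field K] (G V B W : Type) [AddCommGroup G] [Module K G]
    [AddCommGroup V] [Module K V] [AddCommGroup B] [Module K B] [AddCommGroup W] [Module K W] where
  lie : G →ₗ[K] G →ₗ[K] G
  aV : G →ₗ[K] V →ₗ[K] V
  aB : G →ₗ[K] B →ₗ[K] B
  aW : G →ₗ[K] W →ₗ[K] W
  qW : V × B →ₗ[K] V × B →ₗ[K] W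
  qB : V × B →ₗ[K] V × B →ₗ[K] B
  ωV : V →ₗ[K] V →ₗ[K] K
  ωB : B →ₗ[K] B →ₗ[K] K
  pair : W →ₗ[K] G →ₗ[K] K
  lie_skew : ∀ x y, lie x y = -lie y x
  lie_jacobi : ∀ x y z, lie x (lie y z) = lie (lie x y) z + lie y (lie x z)
  aV_lie : ∀ x y p, aV x (aV y p) = aV (lie x y) p + aV y (aV x p)
  aB_lie : ∀ x y p, aB x (aB y p) = aB (lie x y) p + aB y (aB x p)
  aW_lie : ∀ x y p, aW x (aW y p) = aW (lie x y) p + aW y (aW x p)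
  qW_symm : ∀ a b, qW a b = qW b a
  qB_symm : ∀ a b, qB a b = qB b a
  aW_qW : ∀ x a b, aW x (qW a b) = qW (aV x a.1, aB x a.2) b + qW a (aV x b.1, aB x b.2)
  aB_qB : ∀ x a b, aB x (qB a b) = qB (aV x a.1, aB x a.2) b + qB a (aV x b.1, aB x b.2)
  ωV_skew : ∀ v w, ωV v w = -ωV w v
  ωV_inv : ∀ x v w, ωV (aV x v) w = -ωV v (aV x w)
  ωB_inv : ∀ x v w, ωB (aB x v) w = -ωB v (aB x w)
  pair_qW : ∀ x a b, pair (qW a b) x = ωV a.1 (aV x b.1) + ωB a.2 (aB x b.2)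
  pair_inj : ∀ w, (∀ x, pair w x = 0) → w = 0
  ωV_nondeg : ∀ v, (∀ w, ωV v w = 0) → v = 0

namespace TwistData

open MvPolynomial TensorProduct PolyModel

variable {G V B W ι : Type} [AddCommGroup G] [Module K G] [AddCommGroup V] [Module K V]
    [AddCommGroup B] [Module K B] [AddCommGroup W] [Module K W]

/-- The four-term structure with differential `(v, b) ↦ (0, b)`. -/
def toFourTerm (T : TwistData K G V B W) : FourTerm K G (V × B) (W × B) PUnit.{1} where
  lie := T.lie
  a₁ := LinearMap.mk₂ K (fun x p => (T.aV x p.1, T.aB x p.2)) (by simp) (by simp) (by simp)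
    (by simp)
  a₂ := LinearMap.mk₂ K (fun x p => (T.aW x p.1, T.aB x p.2)) (by simp) (by simp) (by simp)
    (by simp)
  a₃ := 0
  q := LinearMap.mk₂ K (fun a b => (T.qW a b, T.qB a b)) (by simp) (by simp) (by simp) (by simp)
  t := 0
  d₁ := LinearMap.inr K W B ∘ₗ LinearMap.snd K V B
  d₂ := 0
  lie_skew := T.lie_skew
  lie_jacobi := T.lie_jacobi
  a₁_lie x y p := Prod.ext (T.aV_lie x y p.1) (T.aB_lie x y p.2)
  a₂_lie x y p := Prod.ext (T.aW_lie x y p.1) (T.aB_lie x y p.2)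
  a₃_lie _ _ _ := rfl
  q_symm a b := Prod.ext (T.qW_symm a b) (T.qB_symm a b)
  a₂_q x a b := Prod.ext (T.aW_qW x a b) (T.aB_qB x a b)
  a₃_t _ _ _ := rfl
  t_jacobi _ _ _ := rfl
  d₁_a x p := Prod.ext (map_zero _).symm rfl
  d₂_a _ _ := rfl
  d_d _ := rfl
  d₂_q _ _ := rfl

/-- The graded Lie algebra on the cohomology. -/
def toQuadData (T : TwistData K G V B W) : QuadData K G V W where
  lie := T.lie
  aV := T.aV
  aW := T.aW
  q := T.qW.compl₁₂ (LinearMap.inl K V B) (LinearMap.inl K V B)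
  lie_skew := T.lie_skew
  lie_jacobi := T.lie_jacobi
  aV_lie := T.aV_lie
  aW_lie := T.aW_lie
  q_symm _ _ := T.qW_symm _ _
  aW_q x a b := by simpa using T.aW_qW x (a, 0) (b, 0)

/-- The action on the degree one part. -/
def act (T : TwistData K G V B W) (x : G) : V × B →ₗ[K] V × B := (T.aV x).prodMap (T.aB x)

/-- The skew form on the degree one part. -/
def ω (T : TwistData K G V B W) : V × B →ₗ[K] V × B →ₗ[K] K :=
  T.ωV.compl₁₂ (LinearMap.fst K V B) (LinearMap.fst K V B) +
    T.ωB.compl₁₂ (LinearMap.snd K V B) (LinearMap.snd K V B)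

theorem ω_apply (T : TwistData K G V B W) (a b : V × B) :
    T.ω a b = T.ωV a.1 b.1 + T.ωB a.2 b.2 := rfl

theorem ω_inv (T : TwistData K G V B W) (x : G) (a b : V × B) :
    T.ω (T.act x a) b = -T.ω a (T.act x b) := by
  simp only [ω_apply, act, LinearMap.prodMap_apply, T.ωV_inv, T.ωB_inv]
  ring

/-- The vector representing a linear functional with respect to the skew form. -/
theorem exists_sharp (T : TwistData K G V B W) [FiniteDimensional K V] :
    ∃ s : (V →ₗ[K] K) →ₗ[K] V, ∀ θ w, T.ωV (s θ) w = θ w := by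
  have hi : Function.Injective T.ωV := by
    rw [injective_iff_map_eq_zero]
    exact fun v hv => T.ωV_nondeg v fun w => LinearMap.congr_fun hv w
  let e := LinearEquiv.ofInjectiveOfFinrankEq T.ωV hi (Subspace.dual_finrank_eq (K := K) (V := V)).symm
  exact ⟨e.symm.toLinearMap, fun θ w => LinearMap.congr_fun (e.apply_symm_apply θ) w⟩

theorem eq_of_ωV (T : TwistData K G V B W) {v v' : V} (h : ∀ w, T.ωV v w = T.ωV v' w) : v = v' :=
  sub_eq_zero.1 (T.ωV_nondeg _ fun w => by rw [map_sub, LinearMap.sub_apply, h, sub_self])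

/-- An equivariant linear map on polynomials. -/
def Equivariant (T : TwistData K G V B W) (b : Module.Basis ι K V)
    (y : MvPolynomial ι K →ₗ[K] V × B) : Prop :=
  ∀ x p, y (der b (T.aV x) p) = T.act x (y p)

theorem lift_zero_left {E : Type} [AddCommGroup E] [Module K E]
    (f : MvPolynomial ι K ⊗[K] MvPolynomial ι K) :
    lift (0 : MvPolynomial ι K →ₗ[K] MvPolynomial ι K →ₗ[K] E) f = 0 :=
  LinearMap.congr_fun (map_zero (lift.equiv (.id K) (MvPolynomial ι K) (MvPolynomial ι K) E)) f

theorem lift_der₂ {E : Type} [AddCommGroup E] [Module K E] (b : Module.Basis ι K V) (A : V →ₗ[K] V)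
    (β : MvPolynomial ι K →ₗ[K] MvPolynomial ι K →ₗ[K] E) (γ : E →ₗ[K] E)
    (h : ∀ a c, β (der b A a) c + β a (der b A c) = γ (β a c))
    (f : MvPolynomial ι K ⊗[K] MvPolynomial ι K) : lift β (der₂ b A f) = γ (lift β f) := by
  induction f using TensorProduct.induction_on with
  | zero => simp
  | add f g hf hg => simp only [map_add, hf, hg]
  | tmul a c => rw [der₂_tmul, map_add, lift.tmul, lift.tmul, lift.tmul, h]

theorem lift_ω_der₂ (T : TwistData K G V B W) (b : Module.Basis ι K V)
    {y y' : MvPolynomial ι K →ₗ[K] V × B} (hy : T.Equivariant b y) (hy' : T.Equivariant b y')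
    (x : G) (f : MvPolynomial ι K ⊗[K] MvPolynomial ι K) :
    lift (T.ω.compl₁₂ y y') (der₂ b (T.aV x) f) = 0 := by
  refine lift_der₂ b _ _ 0 (fun a c => ?_) f
  simp [hy x, hy' x, T.ω_inv]

theorem monomial_of_degree_eq_zero {α : ι →₀ ℕ} (h : α.degree = 0) :
    (monomial α 1 : MvPolynomial ι K) = 1 := by
  rw [(Finsupp.degree_eq_zero_iff α).1 h]
  rfl

variable [Fintype ι]

/-- The linear part of a polynomial as an element of the degree one part. -/
noncomputable def base (_ : TwistData K G V B W) (b : Module.Basis ι K V) :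
    MvPolynomial ι K →ₗ[K] V × B :=
  LinearMap.inl K V B ∘ₗ linPart b

theorem base_apply (T : TwistData K G V B W) (b : Module.Basis ι K V) (p : MvPolynomial ι K) :
    T.base b p = (linPart b p, 0) := rfl

theorem base_equivariant (T : TwistData K G V B W) (b : Module.Basis ι K V) :
    T.Equivariant b (T.base b) := fun x p => by
  simp [base_apply, act]

/-- The operator whose fixed points are the twisting maps. -/
noncomputable def step (T : TwistData K G V B W) (b : Module.Basis ι K V)
    (s : (V →ₗ[K] K) →ₗ[K] V) (y : MvPolynomial ι K →ₗ[K] V × B) :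
    MvPolynomial ι K →ₗ[K] V × B where
  toFun p := (s (-(2⁻¹ : K) • (lift (T.ω.compl₁₂ y y) ∘ₗ
      LinearMap.mulLeft K (ev K ι 1 1 p) ∘ₗ TensorProduct.mk K _ _ 1 ∘ₗ lin b)),
    (2⁻¹ : K) • lift (T.qB.compl₁₂ (T.base b + y) (T.base b + y)) (ev K ι 1 1 p))
  map_add' p r := by
    rw [Prod.mk_add_mk, ← map_add, ← smul_add, ← smul_add, ← map_add, ← map_add]
    refine Prod.ext (congrArg s (LinearMap.ext fun w => ?_)) rfl
    simp [add_mul]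
    ring
  map_smul' c p := by
    refine Prod.ext ?_ ?_
    · change s _ = c • s _
      rw [← map_smul]
      refine congrArg s (LinearMap.ext fun w => ?_)
      simp [smul_mul_assoc]
      ring
    · change _ • _ = c • _ • _
      rw [map_smul, map_smul, smul_comm]

theorem ωV_step (T : TwistData K G V B W) (b : Module.Basis ι K V)
    {s : (V →ₗ[K] K) →ₗ[K] V} (hs : ∀ θ w, T.ωV (s θ) w = θ w)
    (y : MvPolynomial ι K →ₗ[K] V × B) (p : MvPolynomial ι K) (w : V) :
    T.ωV (T.step b s y p).1 w =
      -(2⁻¹ * lift (T.ω.compl₁₂ y y) (ev K ι 1 1 p * (1 ⊗ₜ[K] lin b w))) := by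
  change T.ωV (s _) w = _
  rw [hs]
  simp

theorem step_snd (T : TwistData K G V B W) (b : Module.Basis ι K V)
    (s : (V →ₗ[K] K) →ₗ[K] V) (y : MvPolynomial ι K →ₗ[K] V × B) (p : MvPolynomial ι K) :
    (T.step b s y p).2 =
    (2⁻¹ : K) • lift (T.qB.compl₁₂ (T.base b + y) (T.base b + y)) (ev K ι 1 1 p) := rfl

theorem step_equivariant (T : TwistData K G V B W) (b : Module.Basis ι K V)
    {s : (V →ₗ[K] K) →ₗ[K] V} (hs : ∀ θ w, T.ωV (s θ) w = θ w)
    {y : MvPolynomial ι K →ₗ[K] V × B} (hy : T.Equivariant b y) :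
    T.Equivariant b (T.step b s y) := by
  intro x p
  refine Prod.ext (T.eq_of_ωV fun w => ?_) ?_
  · have h := T.lift_ω_der₂ b hy hy x (ev K ι 1 1 p * (1 ⊗ₜ[K] lin b w))
    rw [der₂_mul, der₂_ev, der₂_tmul, map_add, Derivation.map_one_eq_zero, zero_tmul, zero_add,
      der_lin] at h
    change _ = T.ωV (T.aV x (T.step b s y p).1) w
    rw [T.ωV_inv, ωV_step T b hs, ωV_step T b hs, eq_neg_of_add_eq_zero_right h]
    ring
  · change _ = T.aB x (T.step b s y p).2
    rw [step_snd, step_snd, ← der₂_ev, map_smul]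
    congr 1
    refine lift_der₂ b _ _ _ (fun a c => ?_) _
    have h' : T.Equivariant b (T.base b + y) := fun x p => by
      rw [LinearMap.add_apply, LinearMap.add_apply, map_add, T.base_equivariant b x, hy x]
    simp only [LinearMap.compl₁₂_apply]
    rw [h' x, h' x, T.aB_qB]
    rfl

theorem base_one (T : TwistData K G V B W) (b : Module.Basis ι K V) : T.base b 1 = 0 := by
  simp [base_apply]

section

variable [CharZero K]

theorem step_congr (T : TwistData K G V B W) (b : Module.Basis ι K V)
    (s : (V →ₗ[K] K) →ₗ[K] V) {n : ℕ} {y y' : MvPolynomial ι K →ₗ[K] V × B}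
    (h : Agree 1 y 0) (h' : Agree 1 y' 0) (hn : Agree n y y') :
    Agree (n + 1) (T.step b s y) (T.step b s y') := by
  intro α hα
  have hp := ev_monomial_homogeneous (K := K) α 1
  refine Prod.ext (congrArg s ?_) ?_
  · congr 1
    refine LinearMap.ext fun w => ?_
    refine lift_eq_of_homogeneous (n := α.degree + 1) (fun β β' hβ => ?_) ?_
    · by_cases h₁ : β.degree ≤ 1
      · simp [h β h₁, h' β h₁]
      by_cases h₂ : β'.degree ≤ 1
      · simp [h β' h₂, h' β' h₂]
      simp only [LinearMap.compl₁₂_apply]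
      rw [hn β (by omega), hn β' (by omega)]
    · change ev₂ K ι 2 0 0 2 (ev K ι 1 1 (monomial α 1) * (1 ⊗ₜ[K] lin b w)) =
        _ • (ev K ι 1 1 (monomial α 1) * (1 ⊗ₜ[K] lin b w))
      rw [map_mul, hp, ev₂_tmul, map_one (ev K ι 2 0), ev_lin, pow_succ, mul_smul, zero_smul, zero_add,
        smul_mul_assoc, one_mul, mul_smul_comm]
  · rw [step_snd, step_snd]
    congr 1
    refine lift_eq_of_homogeneous (n := α.degree) (fun β β' hβ => ?_) hp
    simp only [LinearMap.compl₁₂_apply, LinearMap.add_apply]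
    by_cases h₁ : β.degree = 0
    · rw [h β (by omega), h' β (by omega), monomial_of_degree_eq_zero h₁, T.base_one]
      simp
    by_cases h₂ : β'.degree = 0
    · rw [h β' (by omega), h' β' (by omega), monomial_of_degree_eq_zero h₂, T.base_one]
      simp
    rw [hn β (by omega), hn β' (by omega)]

theorem step_vanish (T : TwistData K G V B W) (b : Module.Basis ι K V)
    (s : (V →ₗ[K] K) →ₗ[K] V) {y : MvPolynomial ι K →ₗ[K] V × B}
    (h : Agree 1 y 0) : Agree 1 (T.step b s y) 0 := by
  have h₀ : Agree 1 (T.step b s 0) 0 := by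
    intro α hα
    refine Prod.ext ?_ ?_
    · change s _ = 0
      rw [show (T.ω.compl₁₂ (0 : MvPolynomial ι K →ₗ[K] V × B)
        (0 : MvPolynomial ι K →ₗ[K] V × B)) = 0 from LinearMap.ext₂ fun _ _ => by simp]
      refine (congrArg s (LinearMap.ext fun w => ?_)).trans (map_zero s)
      simp [lift_zero_left]
    · rw [step_snd]
      change _ = (0 : B)
      rw [smul_eq_zero]
      right
      refine (lift_eq_of_homogeneous (B' := 0) (n := α.degree) (fun β β' hβ => ?_)
        (ev_monomial_homogeneous (K := K) α 1)).trans (lift_zero_left _)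
      by_cases h₁ : β.degree = 0
      · simp [monomial_of_degree_eq_zero h₁, T.base_one]
      have h₂ : β'.degree = 0 := by omega
      simp [monomial_of_degree_eq_zero h₂, T.base_one]
  exact fun α hα => (T.step_congr b s (n := 1) h (fun _ _ => rfl) h α (by omega)).trans (h₀ α hα)

/-- The twisting maps exist. -/
theorem exists_twist (T : TwistData K G V B W) (b : Module.Basis ι K V)
    {s : (V →ₗ[K] K) →ₗ[K] V} (hs : ∀ θ w, T.ωV (s θ) w = θ w) :
    ∃ y, T.step b s y = y ∧ Agree 1 y 0 ∧ T.Equivariant b y := by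
  obtain ⟨y, hy, h₁, hn⟩ := exists_fixed_point (T.step b s) (fun _ => T.step_vanish b s)
    (fun _ _ _ => T.step_congr b s)
  refine ⟨y, hy, h₁, fun x => ?_⟩
  have he (n : ℕ) : T.Equivariant b ((T.step b s)^[n] 0) := by
    induction n with
    | zero => exact fun x p => (map_zero _).symm
    | succ n ih =>
      rw [Function.iterate_succ_apply']
      exact T.step_equivariant b hs ih
  suffices y ∘ₗ (der b (T.aV x) : MvPolynomial ι K →ₗ[K] MvPolynomial ι K) = T.act x ∘ₗ y from
    LinearMap.congr_fun this
  refine (basisMonomials ι K).ext fun α => ?_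
  rw [coe_basisMonomials]
  change y (der b (T.aV x) (monomial α 1)) = T.act x (y (monomial α 1))
  rw [(hn α.degree).eq_of_rescale₁ (der_monomial_rescale₁ b _ α), hn _ α le_rfl, he _ x]

end

end TwistData

namespace TwistData

open MvPolynomial TensorProduct PolyModel

variable {G V B W ι : Type} [AddCommGroup G] [Module K G] [AddCommGroup V] [Module K V]
    [AddCommGroup B] [Module K B] [AddCommGroup W] [Module K W]

theorem lift_mul_one_tmul {E : Type} [AddCommGroup E] [Module K E]
    (β : MvPolynomial ι K →ₗ[K] MvPolynomial ι K →ₗ[K] E) (l : MvPolynomial ι K)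
    (f : MvPolynomial ι K ⊗[K] MvPolynomial ι K) :
    lift β (f * (1 ⊗ₜ[K] l)) = lift (β.compl₂ (LinearMap.mulRight K l)) f := by
  induction f using TensorProduct.induction_on with
  | zero => simp
  | add f g hf hg => simp only [add_mul, map_add, hf, hg]
  | tmul a c => simp

theorem lift_mul_tmul_one {E : Type} [AddCommGroup E] [Module K E]
    (β : MvPolynomial ι K →ₗ[K] MvPolynomial ι K →ₗ[K] E) (l : MvPolynomial ι K)
    (f : MvPolynomial ι K ⊗[K] MvPolynomial ι K) :
    lift β (f * (l ⊗ₜ[K] 1)) = lift (β ∘ₗ LinearMap.mulRight K l) f := by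
  induction f using TensorProduct.induction_on with
  | zero => simp
  | add f g hf hg => simp only [add_mul, map_add, hf, hg]
  | tmul a c => simp

theorem lift_add_compl₁₂ {E P : Type} [AddCommGroup E] [Module K E] [AddCommGroup P] [Module K P]
    (β : P →ₗ[K] P →ₗ[K] E) (φ ψ : MvPolynomial ι K →ₗ[K] P)
    (f : MvPolynomial ι K ⊗[K] MvPolynomial ι K) :
    lift (β.compl₁₂ (φ + ψ) (φ + ψ)) f = lift (β.compl₁₂ φ φ) f + lift (β.compl₁₂ φ ψ) f +
      lift (β.compl₁₂ ψ φ) f + lift (β.compl₁₂ ψ ψ) f := by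
  induction f using TensorProduct.induction_on with
  | zero => simp
  | add f g hf hg => simp only [map_add, hf, hg]; abel
  | tmul a c => simp; abel

variable [Fintype ι]

/-- A solution of the fixed point equation defining the twisted morphism. -/
structure IsTwist (T : TwistData K G V B W) (b : Module.Basis ι K V)
    (y : MvPolynomial ι K →ₗ[K] V × B) : Prop where
  map_one : y 1 = 0
  map_lin : ∀ v, y (lin b v) = 0
  equivariant : T.Equivariant b y
  ωV_fst : ∀ p w, T.ωV (y p).1 w =
    -(2⁻¹ * lift (T.ω.compl₁₂ y y) (ev K ι 1 1 p * (1 ⊗ₜ[K] lin b w)))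
  snd : ∀ p, (y p).2 = (2⁻¹ : K) • lift (T.qB.compl₁₂ (T.base b + y) (T.base b + y)) (ev K ι 1 1 p)

theorem exists_isTwist [CharZero K] [FiniteDimensional K V] (T : TwistData K G V B W)
    (b : Module.Basis ι K V) : ∃ y, T.IsTwist b y := by
  obtain ⟨s, hs⟩ := T.exists_sharp
  obtain ⟨y, hy, h₁, he⟩ := T.exists_twist b hs
  refine ⟨y, h₁ 0 (by simp), fun v => ?_, he, fun p w => ?_, fun p => ?_⟩
  · suffices y ∘ₗ lin b = 0 from LinearMap.congr_fun this v
    exact b.ext fun i => by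
      simpa [X] using h₁ (Finsupp.single i 1) (by simp)
  · rw [← T.ωV_step b hs, hy]
  · rw [← T.step_snd b s, hy]

namespace IsTwist

variable {T : TwistData K G V B W} {b : Module.Basis ι K V}
    {y : MvPolynomial ι K →ₗ[K] V × B}

theorem base_add_equivariant (h : T.IsTwist b y) : T.Equivariant b (T.base b + y) := fun x p => by
  rw [LinearMap.add_apply, LinearMap.add_apply, map_add, T.base_equivariant b x, h.equivariant x]

theorem lift_ω_mul_lin [CharZero K] (h : T.IsTwist b y) (p : MvPolynomial ι K) (w : V) :
    lift (T.ω.compl₁₂ (T.base b + y) (T.base b + y)) (ev K ι 1 1 p * (1 ⊗ₜ[K] lin b w)) =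
      lift (T.ω.compl₁₂ (T.base b) (T.base b)) (ev K ι 1 1 p * (1 ⊗ₜ[K] lin b w)) +
      lift (T.ω.compl₁₂ (T.base b) y) (ev K ι 1 1 (p * lin b w)) := by
  have h₁ : lift (T.ω.compl₁₂ y (T.base b)) (ev K ι 1 1 p * (1 ⊗ₜ[K] lin b w)) =
      T.ωV (y p).1 w := by
    rw [lift_mul_one_tmul]
    refine lift_counit_right (θ := T.ωV.flip w ∘ₗ LinearMap.fst K V B ∘ₗ y) (fun a r => ?_) p
    simp [ω_apply, base_apply]
  have h₂ : lift (T.ω.compl₁₂ (T.base b) y) (ev K ι 1 1 p * (lin b w ⊗ₜ[K] 1)) =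
      -T.ωV (y p).1 w := by
    rw [lift_mul_tmul_one]
    refine lift_counit_left (θ := -(T.ωV.flip w ∘ₗ LinearMap.fst K V B ∘ₗ y)) (fun a r => ?_) p
    simp [ω_apply, base_apply, T.ωV_skew w]
  have h₃ := h.ωV_fst p w
  rw [lift_add_compl₁₂, h₁, map_mul (ev K ι 1 1), ev_lin, one_smul, one_smul, mul_add, map_add, h₂, h₃]
  ring

theorem lift_qW_ev [CharZero K] (h : T.IsTwist b y) (p : MvPolynomial ι K) :
    lift (T.qW.compl₁₂ (T.base b + y) (T.base b + y)) (ev K ι 1 1 p) =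
      lift (T.qW.compl₁₂ (T.base b) (T.base b)) (ev K ι 1 1 p) := by
  have key {φ : MvPolynomial ι K →ₗ[K] V × B} (hφ : T.Equivariant b φ) (x : G)
      (f : MvPolynomial ι K ⊗[K] MvPolynomial ι K) :
      T.pair (lift (T.qW.compl₁₂ φ φ) f) x = lift (T.ω.compl₁₂ φ φ)
        (LinearMap.lTensor _ (der b (T.aV x) : MvPolynomial ι K →ₗ[K] MvPolynomial ι K) f) := by
    induction f using TensorProduct.induction_on with
    | zero => simp
    | add f g hf hg => simp only [map_add, LinearMap.add_apply, hf, hg]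
    | tmul a c =>
      simp only [lift.tmul, LinearMap.compl₁₂_apply, LinearMap.lTensor_tmul, T.pair_qW]
      change _ = T.ω (φ a) (φ (der b (T.aV x) c))
      rw [hφ x]
      rfl
  rw [← sub_eq_zero]
  refine T.pair_inj _ fun x => ?_
  rw [map_sub, LinearMap.sub_apply, key h.base_add_equivariant, key (T.base_equivariant b),
    lTensor_der_ev, map_sum, map_sum, sub_eq_zero]
  simp only [h.lift_ω_mul_lin]
  rw [Finset.sum_add_distrib, ← map_sum, ← map_sum, ← map_sum, sum_pderiv_mul, ← der₂_ev,
    T.lift_ω_der₂ b (T.base_equivariant b) h.equivariant, add_zero]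

theorem base_add_one (h : T.IsTwist b y) : (T.base b + y) 1 = 0 := by
  rw [LinearMap.add_apply, T.base_one, h.map_one, add_zero]

theorem base_add_lin (h : T.IsTwist b y) (v : V) : (T.base b + y) (lin b v) = (v, 0) := by
  rw [LinearMap.add_apply, h.map_lin, base_apply, linPart_lin, add_zero]

/-- The bracket of the twisted morphism, minus that of its linear part. -/
noncomputable def quad (_ : T.IsTwist b y) :
    MvPolynomial ι K →ₗ[K] MvPolynomial ι K →ₗ[K] W × B :=
  T.toFourTerm.q.compl₁₂ (T.base b + y) (T.base b + y) -
    (T.qW.compr₂ (LinearMap.inl K W B)).compl₁₂ (T.base b) (T.base b)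

theorem quad_apply (h : T.IsTwist b y) (a c : MvPolynomial ι K) :
    h.quad a c = T.toFourTerm.q ((T.base b + y) a) ((T.base b + y) c) -
      (T.qW (linPart b a, 0) (linPart b c, 0), 0) := rfl

theorem quad_symm (h : T.IsTwist b y) (a c : MvPolynomial ι K) : h.quad a c = h.quad c a := by
  rw [quad_apply, quad_apply, T.toFourTerm.q_symm, T.qW_symm (linPart b a, 0)]

theorem lift_quad_ev [CharZero K] (h : T.IsTwist b y) (p : MvPolynomial ι K) :
    lift h.quad (ev K ι 1 1 p) = (0, (2 : K) • (y p).2) := by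
  have h₁ (f) : lift h.quad f = (lift (T.qW.compl₁₂ (T.base b + y) (T.base b + y)) f -
      lift (T.qW.compl₁₂ (T.base b) (T.base b)) f,
      lift (T.qB.compl₁₂ (T.base b + y) (T.base b + y)) f) := by
    induction f using TensorProduct.induction_on with
    | zero =>
      simp only [map_zero, sub_self]
      rfl
    | add f g hf hg =>
      simp only [map_add, hf, hg, Prod.mk_add_mk]
      exact congrArg (·, _) (by abel)
    | tmul a c =>
      simp only [lift.tmul, quad_apply]
      exact Prod.ext rfl (sub_zero _)
  rw [h₁, h.lift_qW_ev, sub_self, h.snd, smul_smul, mul_inv_cancel₀ two_ne_zero, one_smul]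

theorem lift_quad_coboundary [CharZero K] (h : T.IsTwist b y) (p : MvPolynomial ι K) :
    lift h.quad (coboundary K ι p) = (0, (2 : K) • (y p).2) := by
  rw [coboundary_apply, ev_one_zero, ev_zero_one, map_sub, map_sub, h.lift_quad_ev, lift.tmul,
    lift.tmul, h.quad_symm 1, quad_apply, h.base_add_one]
  simp [← Prod.zero_eq_mk]

/-- The morphism from the polynomial model attached to a twisting map. -/
noncomputable def hom [CharZero K] (h : T.IsTwist b y) :
    FourTerm.Hom (T.toQuadData.poly b) T.toFourTerm where
  f₁ := T.base b + y
  f₂ := ((2⁻¹ : K) • lift h.quad).coprod (LinearMap.inl K W B)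
  f₃ := 0
  lie_eq := rfl
  map_a₁ x p := h.base_add_equivariant x p
  map_a₂ x f := by
    obtain ⟨f, w⟩ := f
    change (2⁻¹ : K) • lift h.quad (der₂ b (T.aV x) f) + (T.aW x w, 0) = T.toFourTerm.a₂ x
      ((2⁻¹ : K) • lift h.quad f + (w, 0))
    rw [map_add, map_smul, lift_der₂ b (T.aV x) h.quad (T.toFourTerm.a₂ x)]
    · exact congrArg _ (Prod.ext rfl (map_zero _).symm)
    · intro a c
      rw [quad_apply, quad_apply, quad_apply, map_sub, T.toFourTerm.a₂_q, h.base_add_equivariant x,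
        h.base_add_equivariant x, linPart_der, linPart_der]
      have h₂ : T.toFourTerm.a₂ x (T.qW (linPart b a, 0) (linPart b c, 0), 0) =
          (T.qW (T.aV x (linPart b a), 0) (linPart b c, 0), 0) +
          (T.qW (linPart b a, 0) (T.aV x (linPart b c), 0), 0) := by
        refine Prod.ext ?_ ?_
        · exact T.toQuadData.aW_q x (linPart b a) (linPart b c)
        · change T.aB x 0 = (0 : B) + 0
          simp
      rw [h₂]
      change T.toFourTerm.q (T.toFourTerm.a₁ x _) _ - _ + (T.toFourTerm.q _ (T.toFourTerm.a₁ x _) - _)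
        = _
      abel
  map_a₃ _ _ := rfl
  map_q a c := by
    change (2⁻¹ : K) • lift h.quad (a ⊗ₜ[K] c + c ⊗ₜ[K] a) +
      (T.qW (linPart b a, 0) (linPart b c, 0), 0) = _
    rw [map_add, lift.tmul, lift.tmul, h.quad_symm c a, ← two_smul K, smul_smul,
      inv_mul_cancel₀ two_ne_zero, one_smul, quad_apply, sub_add_cancel]
  map_t _ _ := rfl
  map_d₁ p := by
    change (2⁻¹ : K) • lift h.quad (coboundary K ι p) + (0, 0) = (0, ((T.base b + y) p).2)
    rw [h.lift_quad_coboundary, Prod.smul_mk, smul_smul, inv_mul_cancel₀ two_ne_zero, one_smul]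
    simp [base_apply]
  map_d₂ _ := rfl

theorem qIso [CharZero K] (h : T.IsTwist b y) :
    QIso (T.toQuadData.poly b).toDGLA T.toFourTerm.toDGLA := by
  refine h.hom.qIso (fun a ha ha' => ?_) (fun v hv => ?_) (fun f e hf he => ?_) (fun f _ => ?_)
    (T.toQuadData.poly_d₂_surjective b) (fun _ => ⟨0, rfl⟩)
  · rw [T.toQuadData.eq_lin_of_poly_d₁_eq_zero b ha] at ha' ⊢
    have : linPart b a = 0 := congrArg Prod.fst ((h.base_add_lin _).symm.trans ha')
    rw [this, map_zero]
  · refine ⟨lin b v.1, T.toQuadData.poly_d₁_lin b _, (h.base_add_lin _).trans ?_⟩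
    exact Prod.ext rfl (congrArg Prod.snd hv).symm
  · obtain ⟨p, hp⟩ := T.toQuadData.exists_of_poly_d₂_eq_zero b hf
    refine ⟨p, Prod.ext hp ?_⟩
    have h₁ : (0, e.2) = (2⁻¹ : K) • lift h.quad f.1 + (f.2, 0) := he
    rw [← hp, h.lift_quad_coboundary] at h₁
    change 0 = f.2
    simpa using congrArg Prod.fst h₁
  · refine ⟨(0, f.1), (0, -f.2), map_zero ((T.toQuadData.poly b).d₂ ∘ₗ LinearMap.inl K _ _), ?_⟩
    change (0, -f.2) = (2⁻¹ : K) • lift h.quad 0 + (f.1, 0) - f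
    rw [map_zero, smul_zero, zero_add]
    exact Prod.ext (sub_self _).symm (zero_sub _).symm

end IsTwist

theorem zigzag [CharZero K] [FiniteDimensional K V] (T : TwistData K G V B W) :
    ZigzagQIso T.toFourTerm.toDGLA T.toQuadData.minimal.toDGLA := by
  let b := Module.finBasis K V
  obtain ⟨y, h⟩ := T.exists_isTwist b
  exact (ZigzagQIso.of h.qIso).symm.trans (.of (T.toQuadData.poly_qIso_minimal b))

end TwistData

namespace DGLA

/-- The bracket as a bilinear map. -/
def brHom (A : DGLA K) : A.carrier →ₗ[K] A.carrier →ₗ[K] A.carrier :=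
  LinearMap.mk₂ K A.br (fun x x' y => (A.br_lin₁ y).map_add x x')
    (fun c x y => (A.br_lin₁ y).map_smul c x) (fun x => (A.br_lin₂ x).map_add)
    (fun c x => (A.br_lin₂ x).map_smul c)

@[simp] theorem brHom_apply (A : DGLA K) (x y : A.carrier) : A.brHom x y = A.br x y := rfl

@[simp] theorem dHom_apply (A : DGLA K) (x : A.carrier) : A.dHom x = A.d x := rfl

theorem coboundaries_le_cocycles (A : DGLA K) (i : ℤ) : A.coboundaries i ≤ A.cocycles i := by
  rintro x ⟨hx, u, rfl⟩
  exact ⟨hx, A.d_sq u⟩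

@[elab_as_elim]
theorem homogeneous_induction (A : DGLA K) {p : A.carrier → Prop} (x : A.carrier)
    (mem : ∀ i, ∀ x ∈ A.grading i, p x) (zero : p 0) (add : ∀ x y, p x → p y → p (x + y)) : p x :=
  Submodule.iSup_induction A.grading (motive := p) (A.internal.submodule_iSup_eq_top ▸ Submodule.mem_top) mem zero
    add

/-- A coboundary is the differential of a homogeneous element. -/
theorem exists_homogeneous_of_mem_coboundaries (A : DGLA K) {i : ℤ} {x : A.carrier}
    (hx : x ∈ A.coboundaries (i + 1)) : ∃ u ∈ A.grading i, A.d u = x := by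
  obtain ⟨hx, u, rfl⟩ := hx
  have key (u : A.carrier) : ∃ v ∈ A.grading i, A.dHom u - A.dHom v ∈ ⨆ (j : ℤ) (_ : j ≠ i + 1), A.grading j := by
    induction u using A.homogeneous_induction with
    | mem j u hu =>
      by_cases hj : j = i
      · exact ⟨u, hj ▸ hu, by rw [sub_self]; exact zero_mem _⟩
      · refine ⟨0, zero_mem _, ?_⟩
        rw [map_zero, sub_zero]
        exact Submodule.mem_iSup_of_mem (j + 1) (Submodule.mem_iSup_of_mem (by omega)
          (A.d_mem j u hu))
    | zero => exact ⟨0, zero_mem _, by rw [sub_self]; exact zero_mem _⟩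
    | add u u' h h' =>
      obtain ⟨v, hv, h⟩ := h
      obtain ⟨v', hv', h'⟩ := h'
      refine ⟨v + v', add_mem hv hv', ?_⟩
      rw [map_add, map_add, add_sub_add_comm]
      exact add_mem h h'
  obtain ⟨v, hv, h⟩ := key u
  refine ⟨v, hv, ?_⟩
  have := (A.internal.submodule_iSupIndep (i + 1)).le_bot ⟨sub_mem hx (A.d_mem i v hv), h⟩
  exact (sub_eq_zero.1 ((Submodule.mem_bot K).1 this)).symm

/-- An element of degree zero anticommutes with everything. -/
theorem br_skew_of_mem_zero (A : DGLA K) {g : A.carrier} (hg : g ∈ A.grading 0) (x : A.carrier) :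
    A.br g x = -A.br x g := by
  induction x using A.homogeneous_induction with
  | mem j x hx => simpa using A.skew 0 j g hg x hx
  | zero =>
    have h₁ := (A.br_lin₂ g).map_zero
    have h₂ := (A.br_lin₁ g).map_zero
    rw [h₁, h₂, neg_zero]
  | add x y h h' =>
    have h₁ := (A.br_lin₂ g).map_add x y
    have h₂ := (A.br_lin₁ g).map_add x y
    rw [h₁, h₂, h, h', neg_add]

/-- A graded subspace closed under the differential and the bracket. -/
structure Sub (A : DGLA K) where
  S : ℤ → Submodule K A.carrier
  le : ∀ i, S i ≤ A.grading i
  d_mem : ∀ i, ∀ x ∈ S i, A.d x ∈ S (i + 1)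
  br_mem : ∀ i j, ∀ x ∈ S i, ∀ y ∈ S j, A.br x y ∈ S (i + j)

namespace Sub

variable {A : DGLA K} (U : A.Sub)

theorem d_mem_iSup {x : A.carrier} (hx : x ∈ ⨆ i, U.S i) : A.dHom x ∈ ⨆ i, U.S i := by
  induction hx using Submodule.iSup_induction' with
  | mem i x hx => exact Submodule.mem_iSup_of_mem _ (U.d_mem i x hx)
  | zero => rw [map_zero]; exact zero_mem _
  | add x y _ _ h h' => rw [map_add]; exact add_mem h h'

theorem br_mem_iSup {x y : A.carrier} (hx : x ∈ ⨆ i, U.S i) (hy : y ∈ ⨆ i, U.S i) :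
    A.brHom x y ∈ ⨆ i, U.S i := by
  induction hx using Submodule.iSup_induction' with
  | mem i x hx =>
    induction hy using Submodule.iSup_induction' with
    | mem j y hy => exact Submodule.mem_iSup_of_mem _ (U.br_mem i j x hx y hy)
    | zero => rw [map_zero]; exact zero_mem _
    | add y y' _ _ h h' => rw [map_add]; exact add_mem h h'
  | zero => rw [map_zero]; exact zero_mem _
  | add x x' _ _ h h' => rw [map_add, LinearMap.add_apply]; exact add_mem h h'

/-- The DG-Lie algebra structure on a graded subspace. -/
def toDGLA : DGLA K where
  carrier := ↥(⨆ i, U.S i)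
  grading i := (U.S i).comap (⨆ i, U.S i).subtype
  internal := by
    rw [DirectSum.isInternal_submodule_iff_iSupIndep_and_iSup_eq_top]
    have hmap (i : ℤ) : ((U.S i).comap (⨆ i, U.S i).subtype).map (⨆ i, U.S i).subtype = U.S i := by
      rw [Submodule.map_comap_subtype, inf_eq_right]
      exact le_iSup U.S i
    have hinj := Submodule.map_injective_of_injective (⨆ i, U.S i).subtype_injective
    constructor
    · intro i
      rw [disjoint_iff]
      refine hinj ?_
      rw [Submodule.map_bot, eq_bot_iff]
      rintro _ ⟨x, ⟨hx, hx'⟩, rfl⟩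
      refine (A.internal.submodule_iSupIndep i).le_bot ⟨U.le i hx, ?_⟩
      have := Submodule.mem_map_of_mem (f := (⨆ i, U.S i).subtype) hx'
      simp only [Submodule.map_iSup, hmap] at this
      exact iSup₂_mono (fun j _ => U.le j) this
    · refine hinj ?_
      simp only [Submodule.map_iSup, hmap, Submodule.map_subtype_top]
  d x := ⟨A.dHom x, U.d_mem_iSup x.2⟩
  d_lin := ⟨fun x y => Subtype.ext (map_add A.dHom _ _), fun c x => Subtype.ext (map_smul A.dHom _ _)⟩
  d_mem i x hx := U.d_mem i x hx
  d_sq x := Subtype.ext (A.d_sq _)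
  br x y := ⟨A.brHom x y, U.br_mem_iSup x.2 y.2⟩
  br_lin₁ y := ⟨fun x x' => Subtype.ext ((A.br_lin₁ y).map_add x x'),
    fun c x => Subtype.ext ((A.br_lin₁ y).map_smul c x)⟩
  br_lin₂ x := ⟨fun y y' => Subtype.ext ((A.br_lin₂ x).map_add y y'),
    fun c y => Subtype.ext ((A.br_lin₂ x).map_smul c y)⟩
  br_mem i j x hx y hy := U.br_mem i j x hx y hy
  skew i j x hx y hy := Subtype.ext (A.skew i j x (U.le i hx) y (U.le j hy))
  jacobi i j x hx y hy z := Subtype.ext (A.jacobi i j x (U.le i hx) y (U.le j hy) z)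
  leibniz i x hx y := Subtype.ext (A.leibniz i x (U.le i hx) y)

theorem mem_cocycles {i : ℤ} {x : ↥(⨆ i, U.S i)} :
    x ∈ U.toDGLA.cocycles i ↔ (x : A.carrier) ∈ U.S i ∧ A.d x = 0 :=
  and_congr Iff.rfl Subtype.ext_iff

theorem mem_coboundaries {i : ℤ} {x : ↥(⨆ i, U.S i)} :
    x ∈ U.toDGLA.coboundaries i ↔ (x : A.carrier) ∈ U.S i ∧ ∃ u ∈ ⨆ i, U.S i, A.d u = x :=
  and_congr Iff.rfl ⟨fun ⟨u, hu⟩ => ⟨u.1, u.2, congrArg Subtype.val hu⟩,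
    fun ⟨u, hu, h⟩ => ⟨⟨u, hu⟩, Subtype.ext h⟩⟩

/-- The inclusion of a graded subspace. -/
def incl : DGLAHom U.toDGLA A where
  toFun x := (⨆ i, U.S i).subtype x
  lin := ⟨fun _ _ => rfl, fun _ _ => rfl⟩
  map_grading i _ hx := U.le i hx
  map_d _ := rfl
  map_br _ _ := rfl

/-- A criterion for the inclusion of a graded subspace to be a quasi-isomorphism. -/
theorem incl_isQuasiIso (inj : ∀ i, ∀ x ∈ U.S (i + 1), x ∈ A.coboundaries (i + 1) →
      ∃ u ∈ U.S i, A.d u = x)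
    (surj : ∀ i, A.cocycles i ≤ (U.S i ⊓ A.cocycles i) ⊔ A.coboundaries i) :
    U.incl.IsQuasiIso := by
  refine fun i => ⟨fun x hx hx' => ?_, fun y hy => ?_⟩
  · have hi : i = (i - 1) + 1 := by ring
    obtain ⟨u, hu, h⟩ := inj (i - 1) ((⨆ i, U.S i).subtype x) (hi ▸ hx.1) (hi ▸ hx')
    exact U.mem_coboundaries.2 ⟨hx.1, u, Submodule.mem_iSup_of_mem _ hu, h⟩
  · obtain ⟨x, hx, z, hz, rfl⟩ := Submodule.mem_sup.1 (surj i hy)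
    refine ⟨⟨x, Submodule.mem_iSup_of_mem i hx.1⟩, U.mem_cocycles.2 ⟨hx.1, hx.2.2⟩, ?_⟩
    change x - (x + z) ∈ _
    rw [sub_add_cancel_left]
    exact neg_mem hz

end Sub

end DGLA

namespace DGLA

/-- A space of representatives of the cohomology in degree `i`. -/
structure IsHarmonic (A : DGLA K) (i : ℤ) (X : Submodule K A.carrier) : Prop where
  le : X ≤ A.cocycles i
  disjoint : Disjoint X (A.coboundaries i)
  le_sup : A.cocycles i ≤ X ⊔ A.coboundaries i

/-- A subspace stable under the adjoint action. -/
def Stable (A : DGLA K) (H X : Submodule K A.carrier) : Prop :=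
  ∀ g ∈ H, ∀ x ∈ X, A.br g x ∈ X

theorem Stable.inf {A : DGLA K} {H X Y : Submodule K A.carrier} (hX : A.Stable H X)
    (hY : A.Stable H Y) : A.Stable H (X ⊓ Y) :=
  fun g hg x hx => ⟨hX g hg x hx.1, hY g hg x hx.2⟩

section

variable {A : DGLA K} {H : Submodule K A.carrier} (hH : H ≤ A.cocycles 0)
include hH

theorem d_br_of_mem {g : A.carrier} (hg : g ∈ H) (x : A.carrier) :
    A.d (A.br g x) = A.br g (A.d x) := by
  have h := A.leibniz 0 g (hH hg).1 x
  have h₁ := (A.br_lin₁ x).map_zero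
  rw [show A.d g = 0 from (hH hg).2, h₁, zpow_zero, one_smul, zero_add] at h
  exact h

theorem jacobi_of_mem {g : A.carrier} (hg : g ∈ H) {i : ℤ} {x : A.carrier} (hx : x ∈ A.grading i)
    (y : A.carrier) : A.br g (A.br x y) = A.br (A.br g x) y + A.br x (A.br g y) := by
  simpa using A.jacobi 0 i g (hH hg).1 x hx y

theorem br_mem_grading {g : A.carrier} (hg : g ∈ H) {i : ℤ} {x : A.carrier} (hx : x ∈ A.grading i) :
    A.br g x ∈ A.grading i := by
  simpa using A.br_mem 0 i g (hH hg).1 x hx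

theorem stable_cocycles (i : ℤ) : A.Stable H (A.cocycles i) := fun g hg x hx =>
  ⟨br_mem_grading hH hg hx.1, by
    have h₁ := (A.br_lin₂ g).map_zero
    change A.d _ = 0
    rw [d_br_of_mem hH hg, show A.d x = 0 from hx.2, h₁]⟩

theorem stable_coboundaries (i : ℤ) : A.Stable H (A.coboundaries i) := by
  rintro g hg _ ⟨hx, u, rfl⟩
  exact ⟨br_mem_grading hH hg hx, A.br g u, d_br_of_mem hH hg u⟩

end

/-- The adjoint action on a stable subspace. -/
def Stable.act {A : DGLA K} {H X : Submodule K A.carrier} (hX : A.Stable H X) :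
    ↥H →ₗ[K] ↥X →ₗ[K] ↥X :=
  LinearMap.mk₂ K (fun g x => ⟨A.brHom g x, hX g g.2 x x.2⟩)
    (fun _ _ _ => Subtype.ext (by simp only [Submodule.coe_add, map_add, LinearMap.add_apply]))
    (fun _ _ _ => Subtype.ext (by simp only [Submodule.coe_smul, map_smul, LinearMap.smul_apply]))
    (fun _ _ _ => Subtype.ext (by simp only [Submodule.coe_add, map_add]))
    (fun _ _ _ => Subtype.ext (by simp only [Submodule.coe_smul, map_smul]))

@[simp] theorem Stable.coe_act {A : DGLA K} {H X : Submodule K A.carrier} (hX : A.Stable H X)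
    (g : H) (x : X) : (hX.act g x : A.carrier) = A.br g x := rfl

theorem Stable.act_act {A : DGLA K} {H X : Submodule K A.carrier} (hX : A.Stable H X)
    (hH : H ≤ A.cocycles 0) (hHH : A.Stable H H) (g g' : H) (x : X) :
    hX.act g (hX.act g' x) = hX.act (hHH.act g g') x + hX.act g' (hX.act g x) :=
  Subtype.ext (jacobi_of_mem hH g.2 (hH g'.2).1 _)

end DGLA

namespace QCyclicDGLA

variable {n : ℤ}

/-- The cyclic form as a bilinear map. -/
def formHom (A : QCyclicDGLA K n) : A.carrier →ₗ[K] A.carrier →ₗ[K] K :=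
  LinearMap.mk₂ K A.form (fun x x' y => (A.form_lin₁ y).map_add x x')
    (fun c x y => (A.form_lin₁ y).map_smul c x) (fun x => (A.form_lin₂ x).map_add)
    (fun c x => (A.form_lin₂ x).map_smul c)

theorem formHom_apply (A : QCyclicDGLA K n) (x y : A.carrier) : A.formHom x y = A.form x y := rfl

variable (A : QCyclicDGLA K n)

theorem form_d_eq_zero {i : ℤ} {u z : A.carrier} (hu : u ∈ A.grading i) (hz : A.d z = 0) :
    A.formHom (A.d u) z = 0 := by
  have h := A.form_d i u hu z
  have h₁ := (A.form_lin₂ u).map_zero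
  rw [hz, h₁, mul_zero] at h
  exact h

theorem form_coboundary_left {i j : ℤ} {x z : A.carrier} (hx : x ∈ A.coboundaries i)
    (hz : z ∈ A.cocycles j) : A.formHom x z = 0 := by
  obtain ⟨i, rfl⟩ : ∃ i', i = i' + 1 := ⟨i - 1, by ring⟩
  obtain ⟨u, hu, rfl⟩ := A.exists_homogeneous_of_mem_coboundaries hx
  exact A.form_d_eq_zero hu hz.2

theorem form_coboundary_right {i j : ℤ} {x z : A.carrier} (hx : x ∈ A.coboundaries i)
    (hz : z ∈ A.cocycles j) : A.formHom z x = 0 := by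
  have h := A.form_coboundary_left hx hz
  rw [formHom_apply] at h ⊢
  rw [A.form_symm j i z hz.1 x hx.1, h, mul_zero]

theorem form_br_left {g : A.carrier} (hg : g ∈ A.grading 0) (x y : A.carrier) :
    A.formHom (A.br g x) y = -A.formHom x (A.br g y) := by
  rw [A.br_skew_of_mem_zero hg, map_neg, LinearMap.neg_apply, formHom_apply, A.form_cyclic,
    formHom_apply]

theorem finiteDimensional_of_isHarmonic {i : ℤ} {X : Submodule K A.carrier}
    (hX : A.IsHarmonic i X) : FiniteDimensional K X := by
  have := A.findim i
  refine FiniteDimensional.of_injective (Submodule.mkQ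
    ((A.coboundaries i).comap (A.cocycles i).subtype) ∘ₗ Submodule.inclusion hX.le) ?_
  rw [injective_iff_map_eq_zero]
  intro x hx
  have h : (x : A.carrier) ∈ A.coboundaries i := (Submodule.Quotient.mk_eq_zero
    ((A.coboundaries i).comap (A.cocycles i).subtype) (x := Submodule.inclusion hX.le x)).1 hx
  exact Subtype.ext (hX.disjoint.le_bot ⟨x.2, h⟩)

variable {A}

theorem eq_zero_of_isHarmonic {i j : ℤ} (hij : i + j = n) {X Y : Submodule K A.carrier}
    (hX : A.IsHarmonic i X) (hY : A.IsHarmonic j Y) {x : A.carrier} (hx : x ∈ X)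
    (h : ∀ y ∈ Y, A.formHom x y = 0) : x = 0 := by
  refine hX.disjoint.le_bot ⟨hx, A.nondeg i x (hX.le hx) fun z hz => ?_⟩
  obtain rfl : n - i = j := by omega
  obtain ⟨y, hy, b, hb, rfl⟩ := Submodule.mem_sup.1 (hY.le_sup hz)
  rw [← formHom_apply, map_add, h y hy, A.form_coboundary_right hb (hX.le hx), add_zero]

/-- A linear map representing the functionals `(x, ·)` on `Y` by elements of `X`. -/
def IsProj (A : QCyclicDGLA K n) {X : Submodule K A.carrier} (Y : Submodule K A.carrier)
    (p : A.carrier →ₗ[K] ↥X) : Prop :=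
  ∀ x, ∀ y ∈ Y, A.formHom (p x) y = A.formHom x y

theorem exists_isProj {i j : ℤ} (hij : i + j = n) {X Y : Submodule K A.carrier}
    (hX : A.IsHarmonic i X) (hY : A.IsHarmonic j Y) :
    ∃ p : A.carrier →ₗ[K] ↥X, A.IsProj Y p := by
  have := A.finiteDimensional_of_isHarmonic hX
  have := A.finiteDimensional_of_isHarmonic hY
  let f : ↥X →ₗ[K] ↥Y →ₗ[K] K := A.formHom.domRestrict₁₂ X Y
  have hf : Function.Injective f := by
    rw [injective_iff_map_eq_zero]
    exact fun x hx => Subtype.ext (eq_zero_of_isHarmonic hij hX hY x.2 fun y hy =>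
      LinearMap.congr_fun hx ⟨y, hy⟩)
  have hf' : Function.Injective f.flip := by
    rw [injective_iff_map_eq_zero]
    refine fun y hy => Subtype.ext (eq_zero_of_isHarmonic (by omega) hY hX y.2 fun x hx => ?_)
    have h : A.form x y = 0 := LinearMap.congr_fun hy ⟨x, hx⟩
    rw [formHom_apply, A.form_symm j i _ (hY.le y.2).1 _ (hX.le hx).1, h, mul_zero]
  have h₁ := LinearMap.finrank_le_finrank_of_injective hf
  have h₂ := LinearMap.finrank_le_finrank_of_injective hf'
  have h₃ : Module.finrank K (↥Y →ₗ[K] K) = Module.finrank K Y := Subspace.dual_finrank_eq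
  have h₄ : Module.finrank K (↥X →ₗ[K] K) = Module.finrank K X := Subspace.dual_finrank_eq
  let e := LinearEquiv.ofInjectiveOfFinrankEq f hf (by omega)
  refine ⟨e.symm.toLinearMap ∘ₗ (Submodule.subtype Y).lcomp K K ∘ₗ A.formHom, fun x y hy => ?_⟩
  exact LinearMap.congr_fun (e.apply_symm_apply (A.formHom x ∘ₗ Y.subtype)) ⟨y, hy⟩

namespace IsProj

variable {i j : ℤ} {X Y : Submodule K A.carrier} {p : A.carrier →ₗ[K] ↥X} (hp : A.IsProj Y p)
    (hij : i + j = n) (hX : A.IsHarmonic i X) (hY : A.IsHarmonic j Y)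
include hp hij hX hY

theorem eq_of_form {x : A.carrier} {x' : X} (h : ∀ y ∈ Y, A.formHom x y = A.formHom x' y) :
    p x = x' := by
  refine Subtype.ext (sub_eq_zero.1 (eq_zero_of_isHarmonic hij hX hY (sub_mem (p x).2 x'.2)
    fun y hy => ?_))
  rw [map_sub, LinearMap.sub_apply, hp x y hy, h y hy, sub_self]

theorem apply_coe (x : X) : p x = x := hp.eq_of_form hij hX hY fun _ _ => rfl

theorem apply_of_mem {k : ℤ} (hk : k ≠ i) {x : A.carrier} (hx : x ∈ A.grading k) : p x = 0 :=
  hp.eq_of_form hij hX hY fun y hy => by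
    have h := A.form_degree k j (by omega) x hx y (hY.le hy).1
    rw [formHom_apply, h]
    simp

theorem apply_coboundary {x : A.carrier} (hx : x ∈ A.coboundaries i) : p x = 0 :=
  hp.eq_of_form hij hX hY fun y hy => by
    rw [A.form_coboundary_left hx (hY.le hy)]
    simp

theorem apply_d (x : A.carrier) : p (A.dHom x) = 0 := by
  induction x using A.homogeneous_induction with
  | mem k x hx =>
    by_cases hk : k + 1 = i
    · exact hp.apply_coboundary hij hX hY (hk ▸ ⟨A.d_mem k x hx, x, rfl⟩)
    · exact hp.apply_of_mem hij hX hY hk (A.d_mem k x hx)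
  | zero => rw [map_zero, map_zero]
  | add x y h h' => rw [map_add, map_add, h, h', add_zero]

theorem apply_br {H : Submodule K A.carrier} (hH : H ≤ A.cocycles 0) (hX' : A.Stable H X)
    (hY' : A.Stable H Y) (g : H) (x : A.carrier) : p (A.br g x) = hX'.act g (p x) :=
  hp.eq_of_form hij hX hY fun y hy => by
    rw [DGLA.Stable.coe_act, A.form_br_left (hH g.2).1, A.form_br_left (hH g.2).1,
      hp x _ (hY' g g.2 y hy)]

end IsProj

end QCyclicDGLA

/-! ### Reduction to twist data -/

/-- Equivariant decompositions of a quasi-cyclic DG-Lie algebra of degree two. -/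
structure Reduction (A : QCyclicDGLA K 2) where
  H : Submodule K A.carrier
  C : Submodule K A.carrier
  P : Submodule K A.carrier
  vanish : ∀ i : ℤ, i ≠ 0 → i ≠ 1 → i ≠ 2 → A.cocycles i ≤ A.coboundaries i
  isHarmonic_H : A.IsHarmonic 0 H
  C_le : C ≤ A.grading 1
  P_le : P ≤ A.grading 2
  stable_H : A.Stable H H
  stable_C : A.Stable H C
  stable_P : A.Stable H P
  C_disjoint : Disjoint C (A.coboundaries 1)
  P_disjoint : Disjoint P (A.coboundaries 2)
  C_sup : A.grading 1 ≤ C ⊔ A.coboundaries 1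
  P_sup : A.grading 2 ≤ P ⊔ A.coboundaries 2

/-- The cocycles in a complement of the coboundaries represent the cohomology. -/
theorem DGLA.isHarmonic_inf {A : DGLA K} {i : ℤ} {C : Submodule K A.carrier}
    (hd : Disjoint C (A.coboundaries i)) (hs : A.grading i ≤ C ⊔ A.coboundaries i) :
    A.IsHarmonic i (C ⊓ A.cocycles i) where
  le := inf_le_right
  disjoint := hd.mono_left inf_le_left
  le_sup x hx := by
    obtain ⟨c, hc, b, hb, rfl⟩ := Submodule.mem_sup.1 (hs hx.1)
    refine Submodule.add_mem_sup ⟨hc, ?_⟩ hb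
    simpa using sub_mem hx (A.coboundaries_le_cocycles i hb)

namespace Reduction

variable {A : QCyclicDGLA K 2} (R : Reduction A)

/-- The harmonic space in degree one. -/
def V : Submodule K A.carrier := R.C ⊓ A.cocycles 1

/-- The harmonic space in degree two. -/
def W : Submodule K A.carrier := R.P ⊓ A.cocycles 2

theorem H_le : R.H ≤ A.cocycles 0 := R.isHarmonic_H.le

theorem isHarmonic_V : A.IsHarmonic 1 R.V := DGLA.isHarmonic_inf R.C_disjoint R.C_sup

theorem isHarmonic_W : A.IsHarmonic 2 R.W := DGLA.isHarmonic_inf R.P_disjoint R.P_sup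

theorem stable_V : A.Stable R.H R.V := R.stable_C.inf (DGLA.stable_cocycles R.H_le 1)

theorem stable_W : A.Stable R.H R.W := R.stable_P.inf (DGLA.stable_cocycles R.H_le 2)

theorem stable_B : A.Stable R.H (A.coboundaries 2) := DGLA.stable_coboundaries R.H_le 2

/-- The projection onto the harmonic space in degree zero. -/
noncomputable def pH : A.carrier →ₗ[K] ↥R.H :=
  (QCyclicDGLA.exists_isProj (zero_add 2) R.isHarmonic_H R.isHarmonic_W).choose

/-- The projection onto the harmonic space in degree one. -/
noncomputable def pV : A.carrier →ₗ[K] ↥R.V :=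
  (QCyclicDGLA.exists_isProj one_add_one_eq_two R.isHarmonic_V R.isHarmonic_V).choose

/-- The projection onto the harmonic space in degree two. -/
noncomputable def pW : A.carrier →ₗ[K] ↥R.W :=
  (QCyclicDGLA.exists_isProj (add_zero 2) R.isHarmonic_W R.isHarmonic_H).choose

theorem isProj_pH : A.IsProj R.W R.pH :=
  (QCyclicDGLA.exists_isProj (zero_add 2) R.isHarmonic_H R.isHarmonic_W).choose_spec

theorem isProj_pV : A.IsProj R.V R.pV :=
  (QCyclicDGLA.exists_isProj one_add_one_eq_two R.isHarmonic_V R.isHarmonic_V).choose_spec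

theorem isProj_pW : A.IsProj R.H R.pW :=
  (QCyclicDGLA.exists_isProj (add_zero 2) R.isHarmonic_W R.isHarmonic_H).choose_spec

theorem pH_coe (x : R.H) : R.pH x = x :=
  R.isProj_pH.apply_coe (zero_add 2) R.isHarmonic_H R.isHarmonic_W x

theorem pV_coe (x : R.V) : R.pV x = x :=
  R.isProj_pV.apply_coe one_add_one_eq_two R.isHarmonic_V R.isHarmonic_V x

theorem pW_coe (x : R.W) : R.pW x = x :=
  R.isProj_pW.apply_coe (add_zero 2) R.isHarmonic_W R.isHarmonic_H x

theorem pH_of_mem {k : ℤ} (hk : k ≠ 0) {x : A.carrier} (hx : x ∈ A.grading k) : R.pH x = 0 :=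
  R.isProj_pH.apply_of_mem (zero_add 2) R.isHarmonic_H R.isHarmonic_W hk hx

theorem pV_of_mem {k : ℤ} (hk : k ≠ 1) {x : A.carrier} (hx : x ∈ A.grading k) : R.pV x = 0 :=
  R.isProj_pV.apply_of_mem one_add_one_eq_two R.isHarmonic_V R.isHarmonic_V hk hx

theorem pW_of_mem {k : ℤ} (hk : k ≠ 2) {x : A.carrier} (hx : x ∈ A.grading k) : R.pW x = 0 :=
  R.isProj_pW.apply_of_mem (add_zero 2) R.isHarmonic_W R.isHarmonic_H hk hx

theorem pH_d (x : A.carrier) : R.pH (A.dHom x) = 0 :=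
  R.isProj_pH.apply_d (zero_add 2) R.isHarmonic_H R.isHarmonic_W x

theorem pV_d (x : A.carrier) : R.pV (A.dHom x) = 0 :=
  R.isProj_pV.apply_d one_add_one_eq_two R.isHarmonic_V R.isHarmonic_V x

theorem pW_coboundary {x : A.carrier} (hx : x ∈ A.coboundaries 2) : R.pW x = 0 := by
  obtain ⟨-, u, rfl⟩ := hx
  exact R.isProj_pW.apply_d (add_zero 2) R.isHarmonic_W R.isHarmonic_H u

theorem pW_d (x : A.carrier) : R.pW (A.dHom x) = 0 :=
  R.isProj_pW.apply_d (add_zero 2) R.isHarmonic_W R.isHarmonic_H x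

theorem pV_br (g : R.H) (x : A.carrier) : R.pV (A.br g x) = R.stable_V.act g (R.pV x) :=
  R.isProj_pV.apply_br one_add_one_eq_two R.isHarmonic_V R.isHarmonic_V R.H_le R.stable_V R.stable_V
    g x

theorem pW_br (g : R.H) (x : A.carrier) : R.pW (A.br g x) = R.stable_W.act g (R.pW x) :=
  R.isProj_pW.apply_br (add_zero 2) R.isHarmonic_W R.isHarmonic_H R.H_le R.stable_W R.stable_H g x

/-- The complement of the harmonic space in `C`. -/
noncomputable def Kc : Submodule K A.carrier := R.C ⊓ LinearMap.ker R.pV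

theorem mem_Kc {x : A.carrier} : x ∈ R.Kc ↔ x ∈ R.C ∧ R.pV x = 0 := Iff.rfl

theorem Kc_le : R.Kc ≤ A.grading 1 := inf_le_left.trans R.C_le

theorem stable_Kc : A.Stable R.H R.Kc := fun g hg x hx =>
  R.mem_Kc.2 ⟨R.stable_C g hg x hx.1, by
    rw [R.pV_br ⟨g, hg⟩, LinearMap.mem_ker.1 hx.2, map_zero]⟩

theorem d_mem_of_grading {x : A.carrier} (hx : x ∈ A.grading 1) : A.d x ∈ A.coboundaries 2 :=
  ⟨A.d_mem 1 x hx, x, rfl⟩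

theorem exists_of_mem_B {b : A.carrier} (hb : b ∈ A.coboundaries 2) :
    ∃ k ∈ R.Kc, A.d k = b := by
  obtain ⟨u, hu, rfl⟩ := A.exists_homogeneous_of_mem_coboundaries (i := 1) hb
  obtain ⟨c, hc, b', hb', rfl⟩ := Submodule.mem_sup.1 (R.C_sup hu)
  refine ⟨c - R.pV c, R.mem_Kc.2 ⟨sub_mem hc (R.pV c).2.1, ?_⟩, ?_⟩
  · rw [map_sub, R.pV_coe, sub_self]
  · have h : A.dHom (R.pV c) = 0 := (R.pV c).2.2.2
    have h' : A.dHom b' = 0 := (A.coboundaries_le_cocycles 1 hb').2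
    rw [← DGLA.dHom_apply, ← DGLA.dHom_apply, map_sub, map_add, h, h', sub_zero, add_zero]

theorem eq_zero_of_mem_Kc {k : A.carrier} (hk : k ∈ R.Kc) (h : A.d k = 0) : k = 0 := by
  have hV : k ∈ R.V := ⟨hk.1, R.Kc_le hk, h⟩
  exact (congrArg Subtype.val (R.pV_coe ⟨k, hV⟩)).symm.trans (congrArg Subtype.val hk.2)

/-- The differential from `Kc` to the coboundaries. -/
noncomputable def dEquiv : ↥R.Kc ≃ₗ[K] ↥(A.coboundaries 2) :=
  LinearEquiv.ofBijective
    (A.dHom.restrict (p := R.Kc) (q := A.coboundaries 2) fun _ hx => d_mem_of_grading (R.Kc_le hx))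
    ⟨(injective_iff_map_eq_zero _).2 fun k hk =>
        Subtype.ext (R.eq_zero_of_mem_Kc k.2 (congrArg Subtype.val hk)),
      fun b => by
        obtain ⟨k, hk, h⟩ := R.exists_of_mem_B b.2
        exact ⟨⟨k, hk⟩, Subtype.ext h⟩⟩

/-- The section of the differential with values in `Kc`. -/
noncomputable def s : ↥(A.coboundaries 2) →ₗ[K] A.carrier :=
  R.Kc.subtype ∘ₗ R.dEquiv.symm.toLinearMap

theorem s_mem (b : A.coboundaries 2) : R.s b ∈ R.Kc := (R.dEquiv.symm b).2

theorem d_s (b : A.coboundaries 2) : A.d (R.s b) = b :=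
  congrArg Subtype.val (R.dEquiv.apply_symm_apply b)

theorem eq_s {k : A.carrier} (hk : k ∈ R.Kc) {b : A.coboundaries 2} (h : A.d k = b) :
    k = R.s b := by
  refine sub_eq_zero.1 (R.eq_zero_of_mem_Kc (sub_mem hk (R.s_mem b)) ?_)
  rw [← DGLA.dHom_apply, map_sub, DGLA.dHom_apply, DGLA.dHom_apply, h, R.d_s, sub_self]

theorem s_act (g : R.H) (b : A.coboundaries 2) : R.s (R.stable_B.act g b) = A.br g (R.s b) :=
  (R.eq_s (R.stable_Kc g g.2 _ (R.s_mem b))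
    (by rw [DGLA.d_br_of_mem R.H_le g.2, R.d_s, DGLA.Stable.coe_act])).symm

theorem eq_of_mem_C {c : A.carrier} (hc : c ∈ R.C) :
    c = R.pV c + R.s ⟨A.d c, d_mem_of_grading (R.C_le hc)⟩ := by
  rw [← sub_eq_iff_eq_add']
  refine R.eq_s (R.mem_Kc.2 ⟨sub_mem hc (R.pV c).2.1, ?_⟩) ?_
  · rw [map_sub, R.pV_coe, sub_self]
  · have h : A.dHom (R.pV c) = 0 := (R.pV c).2.2.2
    rw [← DGLA.dHom_apply, map_sub, h, sub_zero, DGLA.dHom_apply]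

theorem isCompl_B :
    IsCompl (A.coboundaries 2) (R.P ⊔ ⨆ (j : ℤ) (_ : j ≠ 2), A.grading j) := by
  constructor
  · rw [disjoint_iff, eq_bot_iff]
    rintro x ⟨hx, hx'⟩
    obtain ⟨p, hp, r, hr, rfl⟩ := Submodule.mem_sup.1 hx'
    have hr2 : r ∈ A.grading 2 := by simpa using sub_mem hx.1 (R.P_le hp)
    have hr0 : r = 0 := (A.internal.submodule_iSupIndep 2).le_bot ⟨hr2, hr⟩
    rw [hr0, add_zero] at hx ⊢
    exact R.P_disjoint.le_bot ⟨hp, hx⟩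
  · rw [codisjoint_iff, eq_top_iff]
    rintro x -
    induction x using A.homogeneous_induction with
    | mem j x hx =>
      by_cases hj : j = 2
      · subst hj
        obtain ⟨p, hp, b, hb, rfl⟩ := Submodule.mem_sup.1 (R.P_sup hx)
        rw [add_comm]
        exact Submodule.add_mem_sup hb (Submodule.mem_sup_left hp)
      · exact Submodule.mem_sup_right (Submodule.mem_sup_right
          (Submodule.mem_iSup_of_mem j (Submodule.mem_iSup_of_mem hj hx)))
    | zero => exact zero_mem _
    | add x y h h' => exact add_mem h h'

/-- The projection onto the coboundaries in degree two. -/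
noncomputable def pB : A.carrier →ₗ[K] ↥(A.coboundaries 2) :=
  Submodule.projectionOnto _ _ R.isCompl_B

theorem pB_coe (b : A.coboundaries 2) : R.pB b = b :=
  Submodule.projectionOnto_apply_left R.isCompl_B b

theorem pB_of_mem_P {x : A.carrier} (hx : x ∈ R.P) : R.pB x = 0 :=
  (Submodule.projectionOnto_apply_eq_zero_iff R.isCompl_B).2 (Submodule.mem_sup_left hx)

theorem pB_of_mem {k : ℤ} (hk : k ≠ 2) {x : A.carrier} (hx : x ∈ A.grading k) : R.pB x = 0 :=
  (Submodule.projectionOnto_apply_eq_zero_iff R.isCompl_B).2 (Submodule.mem_sup_right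
    (Submodule.mem_iSup_of_mem k (Submodule.mem_iSup_of_mem hk hx)))

theorem pB_br (g : R.H) {x : A.carrier} (hx : x ∈ A.grading 2) :
    R.pB (A.br g x) = R.stable_B.act g (R.pB x) := by
  obtain ⟨p, hp, b, hb, rfl⟩ := Submodule.mem_sup.1 (R.P_sup hx)
  have h₁ := (A.br_lin₂ (g : A.carrier)).map_add p b
  have h₂ := R.pB_coe (R.stable_B.act g ⟨b, hb⟩)
  have h₃ := R.pB_coe ⟨b, hb⟩
  rw [h₁, map_add, map_add, R.pB_of_mem_P hp, R.pB_of_mem_P (R.stable_P g g.2 p hp), zero_add,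
    zero_add]
  exact h₂.trans (by rw [← h₃])

/-- The inclusion of the model in degree one. -/
noncomputable def j : ↥R.V × ↥(A.coboundaries 2) →ₗ[K] A.carrier := R.V.subtype.coprod R.s

theorem j_apply (a : ↥R.V × ↥(A.coboundaries 2)) : R.j a = a.1 + R.s a.2 := rfl

theorem j_mem (a : ↥R.V × ↥(A.coboundaries 2)) : R.j a ∈ A.grading 1 :=
  add_mem (R.C_le a.1.2.1) (R.Kc_le (R.s_mem a.2))

theorem j_act (g : R.H) (a : ↥R.V × ↥(A.coboundaries 2)) :
    R.j (R.stable_V.act g a.1, R.stable_B.act g a.2) = A.br g (R.j a) := by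
  have h := (A.br_lin₂ (g : A.carrier)).map_add a.1 (R.s a.2)
  rw [R.j_apply, R.j_apply, h, R.s_act, DGLA.Stable.coe_act]

theorem br_symm {x y : A.carrier} (hx : x ∈ A.grading 1) (hy : y ∈ A.grading 1) :
    A.br x y = A.br y x := by
  simpa using A.skew 1 1 x hx y hy

theorem form_skew {x y : A.carrier} (hx : x ∈ A.grading 1) (hy : y ∈ A.grading 1) :
    A.formHom x y = -A.formHom y x := by
  simpa [QCyclicDGLA.formHom_apply] using A.form_symm 1 1 x hx y hy

theorem form_s_left (b : A.coboundaries 2) (v : R.V) : A.formHom (R.s b) v = 0 := by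
  rw [← R.isProj_pV (R.s b) v v.2, LinearMap.mem_ker.1 (R.s_mem b).2]
  simp

theorem form_s_right (b : A.coboundaries 2) (v : R.V) : A.formHom v (R.s b) = 0 := by
  rw [form_skew (R.C_le v.2.1) (R.Kc_le (R.s_mem b)), R.form_s_left, neg_zero]

theorem form_j (a c : ↥R.V × ↥(A.coboundaries 2)) :
    A.formHom (R.j a) (R.j c) = A.formHom a.1 c.1 + A.formHom (R.s a.2) (R.s c.2) := by
  simp only [R.j_apply, map_add, LinearMap.add_apply, R.form_s_left, R.form_s_right, add_zero,
    zero_add]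

/-- The twist data of a reduction. -/
noncomputable def toTwistData : TwistData K ↥R.H ↥R.V ↥(A.coboundaries 2) ↥R.W where
  lie := R.stable_H.act
  aV := R.stable_V.act
  aB := R.stable_B.act
  aW := R.stable_W.act
  qW := (A.brHom.compl₁₂ R.j R.j).compr₂ R.pW
  qB := (A.brHom.compl₁₂ R.j R.j).compr₂ R.pB
  ωV := A.formHom.domRestrict₁₂ R.V R.V
  ωB := A.formHom.compl₁₂ R.s R.s
  pair := -A.formHom.domRestrict₁₂ R.W R.H
  lie_skew x y := Subtype.ext (A.br_skew_of_mem_zero (R.H_le x.2).1 y)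
  lie_jacobi x y z := R.stable_H.act_act R.H_le R.stable_H x y z
  aV_lie x y p := R.stable_V.act_act R.H_le R.stable_H x y p
  aB_lie x y p := R.stable_B.act_act R.H_le R.stable_H x y p
  aW_lie x y p := R.stable_W.act_act R.H_le R.stable_H x y p
  qW_symm a b := congrArg R.pW (br_symm (R.j_mem a) (R.j_mem b))
  qB_symm a b := congrArg R.pB (br_symm (R.j_mem a) (R.j_mem b))
  aW_qW x a b := by
    simp only [LinearMap.compr₂_apply, LinearMap.compl₁₂_apply, DGLA.brHom_apply, R.j_act]
    rw [← R.pW_br, DGLA.jacobi_of_mem R.H_le x.2 (R.j_mem a), map_add]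
  aB_qB x a b := by
    simp only [LinearMap.compr₂_apply, LinearMap.compl₁₂_apply, DGLA.brHom_apply, R.j_act]
    rw [← R.pB_br x (A.br_mem 1 1 _ (R.j_mem a) _ (R.j_mem b)),
      DGLA.jacobi_of_mem R.H_le x.2 (R.j_mem a), map_add]
  ωV_skew v w := form_skew (R.C_le v.2.1) (R.C_le w.2.1)
  ωV_inv x v w := A.form_br_left (R.H_le x.2).1 v w
  ωB_inv x v w := by
    simp only [LinearMap.compl₁₂_apply, R.s_act]
    exact A.form_br_left (R.H_le x.2).1 _ _
  pair_qW x a b := by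
    change -A.formHom (R.pW (A.br (R.j a) (R.j b))) x = A.formHom a.1 (R.stable_V.act x b.1) +
      A.formHom (R.s a.2) (R.s (R.stable_B.act x b.2))
    rw [R.isProj_pW _ x x.2, A.formHom_apply, A.form_cyclic,
      ← neg_eq_iff_eq_neg.2 (A.br_skew_of_mem_zero (R.H_le x.2).1 (R.j b)), ← R.j_act,
      ← A.formHom_apply, map_neg, neg_neg, R.form_j]
  pair_inj w hw := Subtype.ext (QCyclicDGLA.eq_zero_of_isHarmonic (add_zero 2) R.isHarmonic_W
    R.isHarmonic_H w.2 fun y hy => neg_eq_zero.1 (hw ⟨y, hy⟩))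
  ωV_nondeg v hv := Subtype.ext (QCyclicDGLA.eq_zero_of_isHarmonic one_add_one_eq_two
    R.isHarmonic_V R.isHarmonic_V v.2 fun y hy => hv ⟨y, hy⟩)

end Reduction

namespace Reduction

variable {A : QCyclicDGLA K 2} (R : Reduction A)

/-- The graded pieces of the subalgebra determined by a reduction. -/
noncomputable def part (i : ℤ) : Submodule K A.carrier :=
  if i < 0 then ⊥ else if i = 0 then R.H else if i = 1 then R.C else A.grading i

theorem part_of_neg {i : ℤ} (hi : i < 0) : R.part i = ⊥ := if_pos hi

theorem part_zero : R.part 0 = R.H := by simp [part]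

theorem part_one : R.part 1 = R.C := by simp [part]

theorem part_of_two_le {i : ℤ} (hi : 2 ≤ i) : R.part i = A.grading i := by
  rw [part, if_neg (by omega), if_neg (by omega), if_neg (by omega)]

theorem part_cases {i : ℤ} {x : A.carrier} (hx : x ∈ R.part i) :
    x = 0 ∨ (i = 0 ∧ x ∈ R.H) ∨ (i = 1 ∧ x ∈ R.C) ∨ (i = 2 ∧ x ∈ A.grading 2) ∨
      (3 ≤ i ∧ x ∈ A.grading i) := by
  rcases lt_or_ge i 0 with h | h
  · rw [R.part_of_neg h] at hx
    exact Or.inl hx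
  obtain rfl | rfl | rfl | h : i = 0 ∨ i = 1 ∨ i = 2 ∨ 3 ≤ i := by omega
  · exact Or.inr (Or.inl ⟨rfl, R.part_zero ▸ hx⟩)
  · exact Or.inr (Or.inr (Or.inl ⟨rfl, R.part_one ▸ hx⟩))
  · rw [R.part_of_two_le le_rfl] at hx
    exact Or.inr (Or.inr (Or.inr (Or.inl ⟨rfl, hx⟩)))
  · rw [R.part_of_two_le (by omega)] at hx
    exact Or.inr (Or.inr (Or.inr (Or.inr ⟨h, hx⟩)))

theorem part_le (i : ℤ) : R.part i ≤ A.grading i := by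
  intro x hx
  rcases R.part_cases hx with rfl | ⟨rfl, h⟩ | ⟨rfl, h⟩ | ⟨rfl, h⟩ | ⟨-, h⟩
  · exact zero_mem _
  · exact (R.H_le h).1
  · exact R.C_le h
  · exact h
  · exact h

theorem br_mem_part_of_mem_H {g : A.carrier} (hg : g ∈ R.H) {i : ℤ} {x : A.carrier}
    (hx : x ∈ R.part i) : A.br g x ∈ R.part i := by
  have h₀ := (A.br_lin₂ g).map_zero
  rcases R.part_cases hx with rfl | ⟨rfl, h⟩ | ⟨rfl, h⟩ | ⟨rfl, h⟩ | ⟨hi, h⟩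
  · rw [h₀]
    exact zero_mem _
  · exact R.part_zero ▸ R.stable_H g hg x h
  · exact R.part_one ▸ R.stable_C g hg x h
  · exact R.part_of_two_le le_rfl ▸ DGLA.br_mem_grading R.H_le hg h
  · exact R.part_of_two_le (i := i) (by omega) ▸ DGLA.br_mem_grading R.H_le hg h

/-- The subalgebra determined by a reduction. -/
noncomputable def sub : A.Sub where
  S := R.part
  le := R.part_le
  d_mem i x hx := by
    have h₀ := A.d_lin.map_zero
    have h₁ := A.d_mem i x (R.part_le i hx)
    rcases R.part_cases hx with rfl | ⟨rfl, h⟩ | ⟨rfl, h⟩ | ⟨rfl, h⟩ | ⟨hi, h⟩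
    · rw [h₀]
      exact zero_mem _
    · rw [show A.d x = 0 from (R.H_le h).2]
      exact zero_mem _
    all_goals rwa [R.part_of_two_le (by omega)]
  br_mem i j x hx y hy := by
    have h₁ := A.br_mem i j x (R.part_le i hx) y (R.part_le j hy)
    by_cases hi : i = 0
    · subst hi
      rw [zero_add]
      exact R.br_mem_part_of_mem_H (R.part_zero ▸ hx) hy
    by_cases hj : j = 0
    · subst hj
      rw [add_zero, ← neg_eq_iff_eq_neg.2 (A.br_skew_of_mem_zero (R.part_le 0 hy) x)]
      exact neg_mem (R.br_mem_part_of_mem_H (R.part_zero ▸ hy) hx)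
    by_cases hi' : i < 0
    · rw [R.part_of_neg hi', Submodule.mem_bot] at hx
      have h₀ := (A.br_lin₁ y).map_zero
      rw [hx, h₀]
      exact zero_mem _
    by_cases hj' : j < 0
    · rw [R.part_of_neg hj', Submodule.mem_bot] at hy
      have h₀ := (A.br_lin₂ x).map_zero
      rw [hy, h₀]
      exact zero_mem _
    rwa [R.part_of_two_le (by omega)]

theorem incl_isQuasiIso : R.sub.incl.IsQuasiIso := by
  refine DGLA.Sub.incl_isQuasiIso _ (fun i (x : A.carrier) (hx : x ∈ R.part (i + 1)) hx' => ?_)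
    fun i (x : A.carrier) hx => ?_
  · have h₀ : ∃ u ∈ R.sub.S i, A.d u = 0 := ⟨0, zero_mem _, A.d_lin.map_zero⟩
    rcases R.part_cases hx with rfl | ⟨hi, h⟩ | ⟨hi, h⟩ | ⟨hi, h⟩ | ⟨hi, h⟩
    · exact h₀
    · rw [hi] at hx'
      rwa [(Submodule.mem_bot K).1 (R.isHarmonic_H.disjoint.le_bot ⟨h, hx'⟩)]
    · rw [hi] at hx'
      rwa [(Submodule.mem_bot K).1 (R.C_disjoint.le_bot ⟨h, hx'⟩)]
    · obtain rfl : i = 1 := by omega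
      obtain ⟨k, hk, rfl⟩ := R.exists_of_mem_B hx'
      exact ⟨k, R.part_one.symm.le hk.1, rfl⟩
    · obtain ⟨u, hu, rfl⟩ := A.exists_homogeneous_of_mem_coboundaries hx'
      exact ⟨u, (R.part_of_two_le (i := i) (by omega)).symm.le hu, rfl⟩
  · change x ∈ (R.part i ⊓ _) ⊔ _
    by_cases h0 : i = 0
    · subst h0
      rw [part_zero, inf_eq_left.2 R.H_le]
      exact R.isHarmonic_H.le_sup hx
    by_cases h1 : i = 1
    · subst h1
      rw [part_one]
      exact R.isHarmonic_V.le_sup hx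
    by_cases h2 : 2 ≤ i
    · rw [R.part_of_two_le h2]
      exact Submodule.mem_sup_left ⟨hx.1, hx⟩
    · exact Submodule.mem_sup_right (R.vanish i h0 h1 (by omega) hx)

/-- The projection onto the four-term model. -/
noncomputable def proj :
    A.carrier →ₗ[K] ↥R.H × (↥R.V × ↥(A.coboundaries 2)) × (↥R.W × ↥(A.coboundaries 2)) ×
      PUnit.{1} :=
  R.pH.prod ((R.pV.prod (R.pB ∘ₗ A.dHom)).prod ((R.pW.prod R.pB).prod 0))

theorem proj_apply (x : A.carrier) :
    R.proj x = (R.pH x, (R.pV x, R.pB (A.dHom x)), (R.pW x, R.pB x), 0) := rfl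

theorem proj_of_mem_H {x : A.carrier} (hx : x ∈ R.H) : R.proj x = (⟨x, hx⟩, 0, 0, 0) := by
  have hd : A.dHom x = 0 := (R.H_le hx).2
  have hx' := (R.H_le hx).1
  rw [R.proj_apply, R.pH_coe ⟨x, hx⟩, R.pV_of_mem (by omega) hx', hd, map_zero,
    R.pW_of_mem (by omega) hx', R.pB_of_mem (by omega) hx']
  rfl

theorem proj_of_mem_C {x : A.carrier} (hx : x ∈ R.C) :
    R.proj x = (0, (R.pV x, ⟨A.dHom x, d_mem_of_grading (R.C_le hx)⟩), 0, 0) := by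
  have hx' := R.C_le hx
  rw [R.proj_apply, R.pH_of_mem (by omega) hx', R.pB_coe ⟨A.dHom x, d_mem_of_grading hx'⟩,
    R.pW_of_mem (by omega) hx', R.pB_of_mem (by omega) hx']
  rfl

theorem proj_of_mem_two {x : A.carrier} (hx : x ∈ A.grading 2) :
    R.proj x = (0, 0, (R.pW x, R.pB x), 0) := by
  rw [R.proj_apply, R.pH_of_mem (by omega) hx, R.pV_of_mem (by omega) hx,
    R.pB_of_mem (x := A.dHom x) (k := 2 + 1) (by omega) (A.d_mem 2 x hx)]
  rfl

theorem proj_of_three_le {i : ℤ} (hi : 3 ≤ i) {x : A.carrier} (hx : x ∈ A.grading i) :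
    R.proj x = 0 := by
  rw [R.proj_apply, R.pH_of_mem (by omega) hx, R.pV_of_mem (by omega) hx,
    R.pB_of_mem (x := A.dHom x) (k := i + 1) (by omega) (A.d_mem i x hx), R.pW_of_mem (by omega) hx,
    R.pB_of_mem (by omega) hx]
  rfl

/-- The projection onto the four-term model as a map of underlying spaces of DG-Lie algebras. -/
noncomputable def projHom : A.carrier →ₗ[K] R.toTwistData.toFourTerm.toDGLA.carrier := R.proj

theorem projHom_mem {i : ℤ} {x : A.carrier} (hx : x ∈ A.grading i) :
    R.projHom x ∈ R.toTwistData.toFourTerm.toDGLA.grading i := by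
  refine FourTerm.mem_gr.2 ⟨fun h => R.pH_of_mem h hx, fun h => ?_, fun h => ?_, fun _ => rfl⟩
  · exact Prod.ext (R.pV_of_mem h hx) (R.pB_of_mem (k := i + 1) (by omega) (A.d_mem i x hx))
  · exact Prod.ext (R.pW_of_mem h hx) (R.pB_of_mem h hx)

theorem j_of_mem_C {x : A.carrier} (hx : x ∈ R.C) :
    R.j (R.pV x, ⟨A.dHom x, d_mem_of_grading (R.C_le hx)⟩) = x :=
  (R.eq_of_mem_C hx).symm

theorem proj_br_of_mem_H {g : A.carrier} (hg : g ∈ R.H) {j : ℤ} {y : A.carrier}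
    (hy : y ∈ R.part j) :
    R.proj (A.br g y) = R.toTwistData.toFourTerm.br (⟨g, hg⟩, 0, 0, 0) (R.proj y) := by
  rcases R.part_cases hy with rfl | ⟨rfl, h⟩ | ⟨rfl, h⟩ | ⟨rfl, h⟩ | ⟨hj, h⟩
  · have h₂ := (A.br_lin₂ g).map_zero
    rw [h₂, map_zero]
    simp [FourTerm.br]
    rfl
  · rw [R.proj_of_mem_H h, R.proj_of_mem_H (R.stable_H g hg y h)]
    simp [FourTerm.br, TwistData.toFourTerm, toTwistData]
    rfl
  · rw [R.proj_of_mem_C h, R.proj_of_mem_C (R.stable_C g hg y h)]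
    simp [FourTerm.br, TwistData.toFourTerm, toTwistData]
    exact ⟨⟨R.pV_br ⟨g, hg⟩ y, Subtype.ext (DGLA.d_br_of_mem R.H_le hg y)⟩, rfl⟩
  · rw [R.proj_of_mem_two h, R.proj_of_mem_two (DGLA.br_mem_grading R.H_le hg h)]
    simp [FourTerm.br, TwistData.toFourTerm, toTwistData]
    exact ⟨rfl, R.pW_br ⟨g, hg⟩ y, R.pB_br ⟨g, hg⟩ h⟩
  · rw [R.proj_of_three_le hj h, R.proj_of_three_le hj (DGLA.br_mem_grading R.H_le hg h)]
    simp [FourTerm.br]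
    rfl

theorem proj_br_of_le {i j : ℤ} (hij : i ≤ j) {x y : A.carrier} (hx : x ∈ R.part i)
    (hy : y ∈ R.part j) :
    R.proj (A.br x y) = R.toTwistData.toFourTerm.br (R.proj x) (R.proj y) := by
  have hxy := A.br_mem i j x (R.part_le i hx) y (R.part_le j hy)
  have h₂ := (A.br_lin₂ x).map_zero
  rcases R.part_cases hx with rfl | ⟨rfl, h⟩ | ⟨rfl, h⟩ | hi
  · have h₁ := (A.br_lin₁ y).map_zero
    rw [h₁, map_zero]
    simp [FourTerm.br]
    rfl
  · rw [R.proj_of_mem_H h, R.proj_br_of_mem_H h hy]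
  · rcases R.part_cases hy with rfl | ⟨rfl, h'⟩ | ⟨rfl, h'⟩ | ⟨rfl, h'⟩ | ⟨hj, h'⟩
    · rw [h₂, map_zero]
      simp [FourTerm.br]
      rfl
    · omega
    · rw [R.proj_of_mem_C h, R.proj_of_mem_C h', R.proj_of_mem_two hxy]
      simp [FourTerm.br, TwistData.toFourTerm, toTwistData, -DGLA.dHom_apply, R.j_of_mem_C h,
        R.j_of_mem_C h']
    · rw [R.proj_of_mem_C h, R.proj_of_mem_two h', R.proj_of_three_le (by omega) hxy]
      simp [FourTerm.br, TwistData.toFourTerm]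
      rfl
    · rw [R.proj_of_mem_C h, R.proj_of_three_le hj h', R.proj_of_three_le (by omega) hxy]
      simp [FourTerm.br]
      rfl
  · have hi' : 2 ≤ i ∧ (R.proj x).1 = 0 ∧ (R.proj x).2.1 = 0 := by
      rcases hi with ⟨rfl, h⟩ | ⟨hi, h⟩
      · rw [R.proj_of_mem_two h]
        exact ⟨le_rfl, rfl, rfl⟩
      · rw [R.proj_of_three_le hi h]
        exact ⟨by omega, rfl, rfl⟩
    have hj' : (R.proj y).1 = 0 ∧ (R.proj y).2.1 = 0 := by
      rcases R.part_cases hy with rfl | ⟨rfl, h'⟩ | ⟨rfl, h'⟩ | ⟨rfl, h'⟩ | ⟨hj, h'⟩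
      · rw [map_zero]
        exact ⟨rfl, rfl⟩
      · omega
      · omega
      · rw [R.proj_of_mem_two h']
        exact ⟨rfl, rfl⟩
      · rw [R.proj_of_three_le hj h']
        exact ⟨rfl, rfl⟩
    rw [R.proj_of_three_le (by omega) hxy]
    simp [FourTerm.br, hi', hj']
    rfl

theorem projHom_br {x y : A.carrier} (hx : x ∈ ⨆ i, R.part i) (hy : y ∈ ⨆ i, R.part i) :
    R.projHom (A.brHom x y) =
      R.toTwistData.toFourTerm.toDGLA.brHom (R.projHom x) (R.projHom y) := by
  induction hx using Submodule.iSup_induction' with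
  | mem i x hx =>
    induction hy using Submodule.iSup_induction' with
    | mem j y hy =>
      rcases le_total i j with h | h
      · exact R.proj_br_of_le h hx hy
      · have h' : R.projHom (A.br y x) =
            R.toTwistData.toFourTerm.toDGLA.br (R.projHom y) (R.projHom x) :=
          R.proj_br_of_le h hy hx
        rw [DGLA.brHom_apply, DGLA.brHom_apply, A.skew i j x (R.part_le i hx) y (R.part_le j hy),
          DGLA.skew _ i j _ (R.projHom_mem (R.part_le i hx)) _ (R.projHom_mem (R.part_le j hy)),
          ← h', map_neg, map_smul]
    | zero => simp only [map_zero]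
    | add y y' _ _ h h' => simp only [map_add, h, h']
  | zero => simp only [map_zero, LinearMap.zero_apply]
  | add x x' _ _ h h' => simp only [map_add, LinearMap.add_apply, h, h']

theorem proj_d (x : A.carrier) :
    R.proj (A.dHom x) = (0, 0, (0, R.pB (A.dHom x)), 0) := by
  rw [R.proj_apply, R.pH_d, R.pV_d, R.pW_d, show A.dHom (A.dHom x) = 0 from A.d_sq x, map_zero]
  rfl

/-- The morphism from the subalgebra onto the four-term model. -/
noncomputable def toModel : DGLAHom R.sub.toDGLA R.toTwistData.toFourTerm.toDGLA where
  toFun x := R.projHom ((⨆ i, R.part i).subtype x)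
  lin := ⟨fun _ _ => map_add (R.projHom ∘ₗ (⨆ i, R.part i).subtype) _ _,
    fun _ _ => map_smul (R.projHom ∘ₗ (⨆ i, R.part i).subtype) _ _⟩
  map_grading i _ hx := R.projHom_mem (R.part_le i hx)
  map_d x := R.proj_d ((⨆ i, R.part i).subtype x)
  map_br x y := R.projHom_br x.2 y.2

theorem toModel_injective {i : ℤ} {x : A.carrier} (hx : x ∈ R.part i) (hd : A.d x = 0)
    (h : (R.proj x).1 = 0 ∧ (R.proj x).2.1 = 0 ∧ (R.proj x).2.2.1.1 = 0) :
    ∃ u ∈ ⨆ i, R.part i, A.d u = x := by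
  rcases R.part_cases hx with rfl | ⟨rfl, hx'⟩ | ⟨rfl, hx'⟩ | ⟨rfl, hx'⟩ | ⟨hi, hx'⟩
  · exact ⟨0, zero_mem _, A.d_lin.map_zero⟩
  · refine ⟨0, zero_mem _, A.d_lin.map_zero.trans ?_⟩
    rw [R.proj_of_mem_H hx'] at h
    exact (congrArg Subtype.val h.1).symm
  · refine ⟨0, zero_mem _, A.d_lin.map_zero.trans ?_⟩
    have hv := R.pV_coe ⟨x, hx', R.C_le hx', hd⟩
    exact ((congrArg Subtype.val hv).symm.trans
      (congrArg (fun a => (a.1 : A.carrier)) h.2.1)).symm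
  · obtain ⟨p, hp, b, hb, rfl⟩ := Submodule.mem_sup.1 (R.P_sup hx')
    have hdb : A.d b = 0 := (A.coboundaries_le_cocycles 2 hb).2
    have hdp : A.d p = 0 := by
      have := A.d_lin.map_add p b
      rwa [hd, hdb, add_zero, eq_comm] at this
    obtain ⟨k, hk, rfl⟩ := R.exists_of_mem_B hb
    have hw := R.pW_coe ⟨p, hp, R.P_le hp, hdp⟩
    have h' : R.pW (p + A.dHom k) = 0 := h.2.2
    rw [map_add, R.pW_d, add_zero] at h'
    have hp0 : p = 0 := (congrArg Subtype.val hw).symm.trans (congrArg Subtype.val h')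
    exact ⟨k, Submodule.mem_iSup_of_mem 1 (R.part_one.symm.le hk.1), by rw [hp0, zero_add]⟩
  · obtain ⟨i, rfl⟩ : ∃ i', i = i' + 1 := ⟨i - 1, by ring⟩
    obtain ⟨u, hu, rfl⟩ := A.exists_homogeneous_of_mem_coboundaries
      (R.vanish (i + 1) (by omega) (by omega) (by omega) ⟨hx', hd⟩)
    exact ⟨u, Submodule.mem_iSup_of_mem i ((R.part_of_two_le (by omega)).symm.le hu), rfl⟩

theorem toModel_surjective {i : ℤ}
    {y : ↥R.H × (↥R.V × ↥(A.coboundaries 2)) × (↥R.W × ↥(A.coboundaries 2)) × PUnit.{1}}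
    (hy : y ∈ R.toTwistData.toFourTerm.toDGLA.cocycles i) :
    ∃ x ∈ R.part i, A.d x = 0 ∧ R.proj x = y := by
  obtain ⟨hg, h1, -⟩ := FourTerm.mem_cocycles.1 hy
  rcases FourTerm.gr_cases hg with rfl | ⟨rfl, g, rfl⟩ | ⟨rfl, a, rfl⟩ | ⟨rfl, f, rfl⟩ | ⟨rfl, u, rfl⟩
  · exact ⟨0, zero_mem _, A.d_lin.map_zero, map_zero _⟩
  · exact ⟨g, R.part_zero.symm.le g.2, (R.H_le g.2).2, R.proj_of_mem_H g.2⟩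
  · have ha : a.2 = 0 := congrArg Prod.snd h1
    refine ⟨a.1, R.part_one.symm.le a.1.2.1, a.1.2.2.2, ?_⟩
    have hd : A.dHom a.1 = 0 := a.1.2.2.2
    rw [R.proj_of_mem_C a.1.2.1, R.pV_coe]
    simp only [hd]
    exact Prod.ext rfl (Prod.ext (Prod.ext rfl ha.symm) rfl)
  · have hw := f.1.2.2
    have hb := A.coboundaries_le_cocycles 2 f.2.2
    refine ⟨f.1 + f.2, (R.part_of_two_le le_rfl).symm.le (add_mem hw.1 hb.1),
      (add_mem hw hb : (f.1 : A.carrier) + f.2 ∈ A.cocycles 2).2, ?_⟩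
    rw [R.proj_of_mem_two (add_mem hw.1 hb.1), map_add, map_add, R.pW_coe, R.pB_coe,
      R.pB_of_mem_P f.1.2.1, R.pW_coboundary f.2.2, add_zero, zero_add]
  · exact ⟨0, zero_mem _, A.d_lin.map_zero, map_zero _⟩

theorem toModel_isQuasiIso : R.toModel.IsQuasiIso := by
  refine fun i => ⟨fun x hx hx' => ?_, fun y hy => ?_⟩
  · obtain ⟨hx, hd⟩ := DGLA.Sub.mem_cocycles _ |>.1 hx
    obtain ⟨-, h₀, h₁, ⟨a, ha⟩, -⟩ := FourTerm.mem_coboundaries.1 hx'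
    exact (DGLA.Sub.mem_coboundaries _).2
      ⟨hx, R.toModel_injective hx hd ⟨h₀, h₁, (congrArg Prod.fst ha).symm⟩⟩
  · obtain ⟨x, hx, hd, rfl⟩ := R.toModel_surjective hy
    refine ⟨⟨x, Submodule.mem_iSup_of_mem i hx⟩, (DGLA.Sub.mem_cocycles _).2 ⟨hx, hd⟩, ?_⟩
    change R.projHom x - R.projHom x ∈ _
    rw [sub_self]
    exact zero_mem _

include R in
theorem isFormal [CharZero K] : A.toDGLA.IsFormal := by
  have := A.finiteDimensional_of_isHarmonic R.isHarmonic_V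
  exact ⟨R.toTwistData.toQuadData.minimal.toDGLA, fun _ => rfl,
    (ZigzagQIso.of ⟨_, R.incl_isQuasiIso⟩).symm.trans
      ((ZigzagQIso.of ⟨_, R.toModel_isQuasiIso⟩).trans R.toTwistData.zigzag)⟩

end Reduction

/-- **Corollary.**  Let `L` be a quasi-cyclic DGLA of degree `2` with `H^i(L) = 0` for
`i ∉ {0,1,2}`.  Assume there is a Lie subalgebra `H⁰ ⊆ Z⁰(L)` such that the projection
`Z⁰(L) → H⁰(L)` restricts to an isomorphism `H⁰ ≅ H⁰(L)` (encoded as: `H⁰` meets the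
coboundaries trivially and every `0`-cocycle lies in `H⁰ + B⁰(L)`) and every graded
piece `L^i` is a completely reducible `H⁰`-module for the adjoint action (encoded by
the standard equivalent characterization: every `H⁰`-stable submodule of `L^i` admits
an `H⁰`-stable complement in `L^i`).  Then `L` is formal. -/
theorem formality_of_quasiCyclic_completely_reducible
    {K : Type} [Field K] [CharZero K]
    (A : QCyclicDGLA K 2)
    (hvanish : ∀ i : ℤ, i ≠ 0 → i ≠ 1 → i ≠ 2 →
      A.toDGLA.cocycles i ≤ A.toDGLA.coboundaries i)
    (H0 : Submodule K A.carrier)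
    (hH0cocycle : H0 ≤ A.toDGLA.cocycles 0)
    (hH0br : ∀ x ∈ H0, ∀ y ∈ H0, A.br x y ∈ H0)
    (hinj : Disjoint H0 (A.toDGLA.coboundaries 0))
    (hsurj : A.toDGLA.cocycles 0 ≤ H0 ⊔ A.toDGLA.coboundaries 0)
    (hcompl : ∀ i : ℤ, ∀ N : Submodule K A.carrier, N ≤ A.grading i →
      (∀ g ∈ H0, ∀ x ∈ N, A.br g x ∈ N) →
      ∃ P : Submodule K A.carrier, P ≤ A.grading i ∧
        (∀ g ∈ H0, ∀ x ∈ P, A.br g x ∈ P) ∧ N ⊓ P = ⊥ ∧ N ⊔ P = A.grading i) :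
    A.toDGLA.IsFormal := by
  obtain ⟨C, hC, hCst, hCi, hCs⟩ := hcompl 1 _ inf_le_left
    (DGLA.stable_coboundaries hH0cocycle 1)
  obtain ⟨P, hP, hPst, hPi, hPs⟩ := hcompl 2 _ inf_le_left
    (DGLA.stable_coboundaries hH0cocycle 2)
  exact Reduction.isFormal
    { H := H0
      C := C
      P := P
      vanish := hvanish
      isHarmonic_H := ⟨hH0cocycle, hinj, hsurj⟩
      C_le := hC
      P_le := hP
      stable_H := hH0br
      stable_C := hCst
      stable_P := hPst
      C_disjoint := (disjoint_iff.2 hCi).symm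
      P_disjoint := (disjoint_iff.2 hPi).symm
      C_sup := (sup_comm C (A.coboundaries 1) ▸ hCs).ge
      P_sup := (sup_comm P (A.coboundaries 2) ▸ hPs).ge }
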